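/- Assume the random transformation 𝓡 satisfies assumption (A1): there exist ε_o > 0 and a sequence Δ_n → 0 such that P( E[L(𝓡(Z)) − L(Z) | Z] ≥ ε_o ) ≥ 1 − Δ_n. Then for every r ≥ 1 and every constant c_o with 0 < c_o < √(2α)/(8 b(q)), for all sufficiently large n: E|L(Z) − E L(Z)|^r ≥ c_o (ε_o √(2α)/16)^r · n^{r/2}; in particular, taking r = 2, Var(L(Z)) ≥ a_o n with a_o := 2 c_o α ε_o² / 16², where α := (1/3) P(Z₁ = 𝐀, Z₃ = 𝐁) and b(q) := √(2π q(1−q)) · exp(1/(2 q(1−q))). -/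

import Mathlib

open Finset

noncomputable section

/-- Law of the first `n` terms `(Z₁, …, Z_n)` of a Markov chain with initial
distribution `π` and transition matrix `p`, as a pmf on `Fin n → S`. -/
def chainLaw {S : Type*} (π : S → ℝ) (p : S → S → ℝ) (n : ℕ) (z : Fin n → S) : ℝ :=
  if hn : 0 < n then
    π (z ⟨0, hn⟩) *
      ∏ i : Fin (n - 1),
        p (z ⟨i.1, by have := i.isLt; omega⟩) (z ⟨i.1 + 1, by have := i.isLt; omega⟩)
  else 1

/-- The position of the first letter of the `i`-th triplet (`0`-indexed). -/
def posA (n : ℕ) (i : Fin (n / 3)) : Fin n := ⟨3 * i.1, by have := i.isLt; omega⟩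
/-- The position of the middle letter of the `i`-th triplet. -/
def posM (n : ℕ) (i : Fin (n / 3)) : Fin n := ⟨3 * i.1 + 1, by have := i.isLt; omega⟩
/-- The position of the last letter of the `i`-th triplet. -/
def posB (n : ℕ) (i : Fin (n / 3)) : Fin n := ⟨3 * i.1 + 2, by have := i.isLt; omega⟩

open Classical in
/-- The random transformation `𝓡` as a Markov kernel: it picks, uniformly at random,
one of the `(𝐀·𝐁)`-triplets whose middle letter is not `𝐃`, and replaces that middle
letter by `𝐃` (acting as the identity if there is no such triplet). -/
def kernelR {S : Type*} (A B D : S) (n : ℕ) (z z' : Fin n → S) : ℝ :=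
  let J : Finset (Fin (n / 3)) := univ.filter fun i =>
    z (posA n i) = A ∧ z (posB n i) = B ∧ z (posM n i) ≠ D
  if J.Nonempty then
    ((J.filter fun i => Function.update z (posM n i) D = z').card : ℝ) / J.card
  else if z' = z then 1 else 0

open Classical in
/-- Probability of an event under a pmf on a finite type. -/
def prOf {Ω : Type*} [Fintype Ω] (P : Ω → ℝ) (E : Ω → Prop) : ℝ :=
  ∑ z, if E z then P z else 0

/-- The optimal alignment score of two words `x, y ∈ 𝔸ⁿ`, given a pairwise scoring
function `S` and a gap price `δ`: the maximum over all alignments (pairs of strictly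
increasing index sequences `ρ, τ : Fin k → Fin n`, including the empty one `k = 0`) of
`Σᵢ S(x(ρᵢ), y(τᵢ)) + δ(n - k)`. -/
def alignScore {𝔸 : Type*} (S : 𝔸 → 𝔸 → ℝ) (δ : ℝ) (n : ℕ) (x y : Fin n → 𝔸) : ℝ :=
  sSup {s : ℝ | ∃ (k : ℕ) (ρ τ : Fin k → Fin n), StrictMono ρ ∧ StrictMono τ ∧
    s = (∑ i, S (x (ρ i)) (y (τ i))) + δ * ((n : ℝ) - (k : ℝ))}

/-- The global score `L(Z) = L(X,Y)` of a pairwise sequence `z ∈ (𝔸×𝔸)ⁿ`. -/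
def scoreL {𝔸 : Type*} (S : 𝔸 → 𝔸 → ℝ) (δ : ℝ) (n : ℕ) (z : Fin n → 𝔸 × 𝔸) : ℝ :=
  alignScore S δ n (fun i => (z i).1) (fun i => (z i).2)

/-! ### Part 1: the score is Lipschitz -/

lemma alignSet_bdd {𝔸 : Type*} [Fintype 𝔸] (S : 𝔸 → 𝔸 → ℝ) (δ : ℝ) (C : ℝ)
    (hC : ∀ a b, S a b ≤ C) (hC0 : 0 ≤ C) (n : ℕ) (x y : Fin n → 𝔸) :
    BddAbove {s : ℝ | ∃ (k : ℕ) (ρ τ : Fin k → Fin n), StrictMono ρ ∧ StrictMono τ ∧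
    s = (∑ i, S (x (ρ i)) (y (τ i))) + δ * ((n : ℝ) - (k : ℝ))} := by
  refine ⟨n * C + |δ| * n, ?_⟩
  rintro s ⟨k, ρ, τ, hρ, hτ, rfl⟩
  have hk : k ≤ n := by
    simpa using Fintype.card_le_of_injective ρ hρ.injective
  have hk' : (k : ℝ) ≤ n := by exact_mod_cast hk
  have h1 : (∑ i, S (x (ρ i)) (y (τ i))) ≤ k * C := by
    calc _ ≤ ∑ i : Fin k, C := Finset.sum_le_sum fun i _ => hC _ _
      _ = k * C := by simp
  have h2 : δ * ((n : ℝ) - k) ≤ |δ| * n := by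
    have hk0 : (0 : ℝ) ≤ k := by positivity
    calc _ ≤ |δ| * ((n : ℝ) - k) := by
          apply mul_le_mul_of_nonneg_right (le_abs_self δ); linarith
      _ ≤ _ := by apply mul_le_mul_of_nonneg_left _ (abs_nonneg δ); linarith
  have h3 : (k : ℝ) * C ≤ n * C := mul_le_mul_of_nonneg_right hk' hC0
  linarith

lemma sum_ind_le_one {k n : ℕ} (ρ : Fin k → Fin n) (hρ : Function.Injective ρ) (j : Fin n) :
    (∑ i, if ρ i = j then (1 : ℝ) else 0) ≤ 1 := by
  rw [Finset.sum_boole]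
  have : (univ.filter fun i => ρ i = j).card ≤ 1 := by
    rw [Finset.card_le_one]
    intro a ha b hb
    simp only [Finset.mem_filter] at ha hb
    exact hρ (ha.2.trans hb.2.symm)
  exact_mod_cast this

lemma score_lip {𝔸 : Type*} [Fintype 𝔸] (S : 𝔸 → 𝔸 → ℝ) (δ : ℝ) (C : ℝ)
    (hS : ∀ a b, 0 ≤ S a b)
    (hC : ∀ a b, S a b ≤ C) (hC0 : 0 ≤ C) (n : ℕ) (z : Fin n → 𝔸 × 𝔸) (j : Fin n) (d : 𝔸 × 𝔸) :
    scoreL S δ n z - 2 * C ≤ scoreL S δ n (Function.update z j d) := by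
  have key : scoreL S δ n z ≤ scoreL S δ n (Function.update z j d) + 2 * C := by
    unfold scoreL alignScore
    apply csSup_le
    · exact ⟨_, 0, Fin.elim0, Fin.elim0, fun a => a.elim0, fun a => a.elim0, rfl⟩
    rintro s ⟨k, ρ, τ, hρ, hτ, rfl⟩
    have hle := le_csSup (alignSet_bdd S δ C hC hC0 n
      (fun i => (Function.update z j d i).1) (fun i => (Function.update z j d i).2))
      ⟨k, ρ, τ, hρ, hτ, rfl⟩
    have : (∑ i, S (z (ρ i)).1 (z (τ i)).2) ≤
        (∑ i, S (Function.update z j d (ρ i)).1 (Function.update z j d (τ i)).2) + 2 * C := by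
      have h1 := sum_ind_le_one ρ hρ.injective j
      have h2 := sum_ind_le_one τ hτ.injective j
      calc (∑ i, S (z (ρ i)).1 (z (τ i)).2) ≤
          ∑ i, (S (Function.update z j d (ρ i)).1 (Function.update z j d (τ i)).2 +
            C * (if ρ i = j then (1 : ℝ) else 0) + C * (if τ i = j then (1 : ℝ) else 0)) := by
            apply Finset.sum_le_sum
            intro i _
            by_cases h : ρ i = j
            · have := hC (z (ρ i)).1 (z (τ i)).2
              have h' := hS (Function.update z j d (ρ i)).1 (Function.update z j d (τ i)).2
              rw [if_pos h]
              split_ifs <;> linarith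
            · by_cases h3 : τ i = j
              · have := hC (z (ρ i)).1 (z (τ i)).2
                have h' := hS (Function.update z j d (ρ i)).1 (Function.update z j d (τ i)).2
                rw [if_pos h3, if_neg h]
                linarith
              · rw [if_neg h, if_neg h3, Function.update_of_ne h, Function.update_of_ne h3]
                simp
        _ ≤ _ := by
            rw [Finset.sum_add_distrib, Finset.sum_add_distrib, ← Finset.mul_sum,
              ← Finset.mul_sum]
            nlinarith
    linarith
  linarith
/-! ### Part 2: the Markov chain -/

lemma chainLaw_nonneg {S : Type*} (π : S → ℝ) (p : S → S → ℝ) (hπ : ∀ x, 0 ≤ π x)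
    (hp : ∀ x y, 0 ≤ p x y) (n : ℕ) (z : Fin n → S) : 0 ≤ chainLaw π p n z := by
  unfold chainLaw
  split_ifs
  · exact mul_nonneg (hπ _) (Finset.prod_nonneg fun i _ => hp _ _)
  · norm_num

lemma chainLaw_cons {S : Type*} (π : S → ℝ) (p : S → S → ℝ) (n : ℕ) (x : S) (z : Fin n → S) :
    chainLaw π p (n + 1) (Fin.cons x z) = π x * chainLaw (p x) p n z := by
  cases n with
  | zero => simp [chainLaw]
  | succ n =>
    unfold chainLaw
    rw [dif_pos (by omega), dif_pos (by omega)]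
    have e : (∏ i : Fin (n + 1 + 1 - 1),
        p ((Fin.cons x z : Fin (n + 1 + 1) → S) ⟨i.1, by have := i.isLt; omega⟩)
          ((Fin.cons x z : Fin (n + 1 + 1) → S) ⟨i.1 + 1, by have := i.isLt; omega⟩))
        = p x (z 0) * ∏ i : Fin (n + 1 - 1), p (z ⟨i.1, by have := i.isLt; omega⟩)
          (z ⟨i.1 + 1, by have := i.isLt; omega⟩) := by
      change (∏ i : Fin (n + 1),
        p ((Fin.cons x z : Fin (n + 1 + 1) → S) ⟨i.1, by have := i.isLt; omega⟩)
          ((Fin.cons x z : Fin (n + 1 + 1) → S) ⟨i.1 + 1, by have := i.isLt; omega⟩)) = _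
      rw [Fin.prod_univ_succ]
      rfl
    rw [e]
    rfl

/-- expectation of a product functional -/
def wprod {S : Type*} [Fintype S] (π : S → ℝ) (p : S → S → ℝ) (n : ℕ) (f : ℕ → S → ℝ) : ℝ :=
  ∑ z : Fin n → S, chainLaw π p n z * ∏ i : Fin n, f i (z i)

lemma wprod_succ {S : Type*} [Fintype S] (π : S → ℝ) (p : S → S → ℝ) (n : ℕ) (f : ℕ → S → ℝ) :
    wprod π p (n + 1) f = ∑ x, π x * f 0 x * wprod (p x) p n (fun i => f (i + 1)) := by
  unfold wprod
  rw [← (Fin.consEquiv (fun _ : Fin (n + 1) => S)).sum_comp, Fintype.sum_prod_type]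
  apply Finset.sum_congr rfl
  intro x _
  rw [Finset.mul_sum]
  apply Finset.sum_congr rfl
  intro z _
  change chainLaw π p (n + 1) (Fin.cons x z) *
    ∏ i : Fin (n + 1), f i ((Fin.cons x z : Fin (n + 1) → S) i) = _
  rw [chainLaw_cons, Fin.prod_univ_succ]
  simp
  ring

lemma wprod_zero {S : Type*} [Fintype S] (π : S → ℝ) (p : S → S → ℝ) (f : ℕ → S → ℝ) :
    wprod π p 0 f = 1 := by
  simp [wprod, chainLaw]

lemma wprod_one {S : Type*} [Fintype S] (π : S → ℝ) (p : S → S → ℝ) (hπ : ∑ x, π x = 1)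
    (hp : ∀ x, ∑ y, p x y = 1) (n : ℕ) (f : ℕ → S → ℝ) (hf : ∀ i < n, ∀ x, f i x = 1) :
    wprod π p n f = 1 := by
  induction n generalizing π f with
  | zero => exact wprod_zero _ _ _
  | succ n ih =>
    rw [wprod_succ, ← hπ]
    apply Finset.sum_congr rfl
    intro x _
    rw [ih (p x) (hp x) (fun i => f (i + 1)) (fun i hi => hf _ (by omega)), hf 0 (by omega)]
    ring

lemma chainLaw_sum {S : Type*} [Fintype S] (π : S → ℝ) (p : S → S → ℝ) (hπ : ∑ x, π x = 1)
    (hp : ∀ x, ∑ y, p x y = 1) (n : ℕ) : ∑ z : Fin n → S, chainLaw π p n z = 1 := by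
  have := wprod_one π p hπ hp n (fun _ _ => 1) (fun _ _ _ => rfl)
  simpa [wprod] using this

/-- skip `k` initial trivial factors -/
lemma wprod_skip {S : Type*} [Fintype S] [DecidableEq S] (π : S → ℝ) (p : S → S → ℝ)
    (n k : ℕ) (f : ℕ → S → ℝ) (hf : ∀ i < k, ∀ x, f i x = 1) :
    wprod π p (n + 1 + k) f
      = wprod (fun y => ∑ x, π x * (Matrix.of p ^ k) x y) p (n + 1) (fun i => f (i + k)) := by
  induction k generalizing π f with
  | zero => simp [Matrix.one_apply]
  | succ k ih =>
    have e : n + 1 + (k + 1) = (n + 1 + k) + 1 := by ring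
    rw [e, wprod_succ]
    have : ∀ x, π x * f 0 x * wprod (p x) p (n + 1 + k) (fun i => f (i + 1))
      = π x * wprod (fun y => ∑ x', p x x' * (Matrix.of p ^ k) x' y) p (n + 1)
        (fun i => f (i + k + 1)) := by
      intro x
      rw [hf 0 (by omega), ih (p x) (fun i => f (i + 1)) (fun i hi => hf _ (by omega)), mul_one]
    rw [Finset.sum_congr rfl fun x _ => this x]
    simp only [wprod_succ]
    simp only [Finset.mul_sum]
    rw [Finset.sum_comm]
    apply Finset.sum_congr rfl
    intro y _
    rw [Finset.sum_mul, Finset.sum_mul]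
    apply Finset.sum_congr rfl
    intro x _
    rw [pow_succ', Matrix.mul_apply]
    simp only [Matrix.of_apply]
    have e2 : ∀ i, i + 1 + (k + 1) = i + 1 + k + 1 := fun i => by ring
    have e3 : 0 + (k + 1) = 0 + k + 1 := by ring
    simp only [e2, e3]
    ring

/-- indicator -/
def ind {S : Type*} [DecidableEq S] (a x : S) : ℝ := if x = a then 1 else 0

lemma wprod_triplet {S : Type*} [Fintype S] [DecidableEq S] (π : S → ℝ) (p : S → S → ℝ)
    (A B : S) (n : ℕ) (f : ℕ → S → ℝ) (h0 : ∀ x, f 0 x = ind A x) (h1 : ∀ x, f 1 x = 1)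
    (h2 : ∀ x, f 2 x = ind B x) :
    wprod π p (n + 3) f
      = π A * (∑ C, p A C * p C B) * wprod (p B) p n (fun i => f (i + 3)) := by
  rw [wprod_succ]
  simp only [h0, ind, mul_ite, mul_one, mul_zero, ite_mul, zero_mul, Finset.sum_ite_eq',
    Finset.mem_univ, if_true]
  rw [wprod_succ, mul_assoc, Finset.sum_mul]
  congr 1
  apply Finset.sum_congr rfl
  intro C _
  rw [wprod_succ]
  simp only [h1, h2, ind, mul_ite, mul_one, mul_zero, ite_mul, zero_mul, Finset.sum_ite_eq',
    Finset.mem_univ, if_true, zero_add, Nat.reduceAdd]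
  ring_nf

lemma osc_step {S : Type*} [Fintype S] (M : S → S → ℝ) (hM : ∀ x y, 0 ≤ M x y)
    (hrow : ∀ x, ∑ y, M x y = 1) (c : ℝ) (hc : 0 ≤ c) (z0 : S) (hz0 : ∀ x, c ≤ M x z0)
    (f : S → ℝ) (w : ℝ) (hw : 0 ≤ w) (hf : ∀ x x', f x - f x' ≤ w) (x x' : S) :
    (∑ z, M x z * f z) - (∑ z, M x' z * f z) ≤ (1 - c ^ 2) * w := by
  classical
  have e1 : (∑ z, M x z * f z) - (∑ z, M x' z * f z)
      = ∑ z, ∑ z', M x z * M x' z' * (f z - f z') := by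
    have a : (∑ z, M x z * f z) = ∑ z, ∑ z', M x z * M x' z' * f z := by
      apply Finset.sum_congr rfl
      intro z _
      rw [← Finset.sum_mul, ← Finset.mul_sum, hrow, mul_one]
    have b : (∑ z, M x' z * f z) = ∑ z, ∑ z', M x z * M x' z' * f z' := by
      rw [Finset.sum_comm]
      apply Finset.sum_congr rfl
      intro z _
      rw [← Finset.sum_mul, ← Finset.sum_mul, hrow, one_mul]
    rw [a, b, ← Finset.sum_sub_distrib]
    apply Finset.sum_congr rfl
    intro z _
    rw [← Finset.sum_sub_distrib]
    apply Finset.sum_congr rfl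
    intro z' _
    ring
  have e2 : ∑ z, ∑ z', (M x z * M x' z' * w - if z = z0 then
      (if z' = z0 then M x z * M x' z' * w else 0) else 0)
      = w - M x z0 * M x' z0 * w := by
    simp only [Finset.sum_sub_distrib]
    congr 1
    · simp only [← Finset.sum_mul, ← Finset.mul_sum, hrow, mul_one, one_mul]
    · rw [Finset.sum_eq_single z0]
      · simp
      · intro b _ hb; simp [hb]
      · simp
  have e3 : (∑ z, M x z * f z) - (∑ z, M x' z * f z) ≤ w - M x z0 * M x' z0 * w := by
    rw [e1, ← e2]
    apply Finset.sum_le_sum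
    intro z _
    apply Finset.sum_le_sum
    intro z' _
    by_cases h : z = z0 ∧ z' = z0
    · obtain ⟨rfl, rfl⟩ := h
      simp
    · have : (if z = z0 then (if z' = z0 then M x z * M x' z' * w else 0) else 0) = 0 := by
        split_ifs <;> tauto
      rw [this, sub_zero]
      exact mul_le_mul_of_nonneg_left (hf _ _) (mul_nonneg (hM _ _) (hM _ _))
  have e4 : c ^ 2 ≤ M x z0 * M x' z0 := by
    rw [sq]; exact mul_le_mul (hz0 x) (hz0 x') hc (hM _ _)
  nlinarith

lemma pow_stoch {S : Type*} [Fintype S] [DecidableEq S] (p : S → S → ℝ)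
    (hpnn : ∀ x y, 0 ≤ p x y) (hprow : ∀ x, ∑ y, p x y = 1) (k : ℕ) :
    (∀ x y, 0 ≤ (Matrix.of p ^ k) x y) ∧ (∀ x, ∑ y, (Matrix.of p ^ k) x y = 1) := by
  induction k with
  | zero =>
    constructor
    · intro x y; rw [pow_zero, Matrix.one_apply]; split_ifs <;> norm_num
    · intro x; simp [Matrix.one_apply]
  | succ k ih =>
    constructor
    · intro x y
      rw [pow_succ', Matrix.mul_apply]
      exact Finset.sum_nonneg fun z _ => mul_nonneg (hpnn _ _) (ih.1 _ _)
    · intro x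
      simp only [pow_succ', Matrix.mul_apply]
      rw [Finset.sum_comm]
      simp only [← Finset.mul_sum, ih.2, mul_one, Matrix.of_apply, hprow]

lemma pow_stat {S : Type*} [Fintype S] [DecidableEq S] (p : S → S → ℝ) (π : S → ℝ)
    (hstat : ∀ y, ∑ x, π x * p x y = π y) (k : ℕ) (y : S) :
    ∑ x, π x * (Matrix.of p ^ k) x y = π y := by
  induction k generalizing y with
  | zero => simp [Matrix.one_apply]
  | succ k ih =>
    simp only [pow_succ', Matrix.mul_apply, Finset.mul_sum]
    rw [Finset.sum_comm]
    simp only [← mul_assoc, ← Finset.sum_mul, Matrix.of_apply, hstat, ih]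

lemma mixing {S : Type*} [Fintype S] [DecidableEq S] (p : S → S → ℝ)
    (hpnn : ∀ x y, 0 ≤ p x y) (hprow : ∀ x, ∑ y, p x y = 1)
    (π : S → ℝ) (hπnn : ∀ x, 0 ≤ π x) (hπsum : ∑ x, π x = 1)
    (hstat : ∀ y, ∑ x, π x * p x y = π y)
    (haper : ∃ m : ℕ, ∀ x y, 0 < (Matrix.of p ^ m) x y) (y : S) (θ : ℝ) (hθ : 0 < θ) :
    ∃ K : ℕ, ∀ k ≥ K, ∀ x, (Matrix.of p ^ k) x y ≤ π y + θ := by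
  obtain ⟨m, hm⟩ := haper
  have : Nonempty S := ⟨y⟩
  obtain ⟨x0, hx0⟩ := Finite.exists_min (fun x => (Matrix.of p ^ m) x y)
  set c := (Matrix.of p ^ m) x0 y with hc
  have hcpos : 0 < c := hm _ _
  have hc1 : c ≤ 1 := by
    rw [← (pow_stoch p hpnn hprow m).2 x0]
    exact Finset.single_le_sum (fun z _ => (pow_stoch p hpnn hprow m).1 x0 z) (Finset.mem_univ y)
  have hc2 : 0 ≤ 1 - c ^ 2 := by nlinarith
  have mono : ∀ (w : ℝ), 0 ≤ w → ∀ a, (∀ x x', (Matrix.of p ^ a) x y - (Matrix.of p ^ a) x' y ≤ w) →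
      ∀ b, ∀ x x', (Matrix.of p ^ (b + a)) x y - (Matrix.of p ^ (b + a)) x' y ≤ w := by
    intro w hw a ha b x x'
    have := osc_step (fun x z => (Matrix.of p ^ b) x z) (pow_stoch p hpnn hprow b).1
      (pow_stoch p hpnn hprow b).2 0 le_rfl y (fun x => (pow_stoch p hpnn hprow b).1 x y)
      (fun x => (Matrix.of p ^ a) x y) w hw ha x x'
    rw [pow_add, Matrix.mul_apply, Matrix.mul_apply]
    simpa using this
  have iter : ∀ j : ℕ, ∀ x x', (Matrix.of p ^ (m * j)) x y - (Matrix.of p ^ (m * j)) x' y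
      ≤ (1 - c ^ 2) ^ j := by
    intro j
    induction j with
    | zero =>
      intro x x'
      simp only [mul_zero, pow_zero, Matrix.one_apply]
      split_ifs <;> norm_num
    | succ j ih =>
      intro x x'
      have := osc_step (fun x z => (Matrix.of p ^ m) x z) (pow_stoch p hpnn hprow m).1
        (pow_stoch p hpnn hprow m).2 c hcpos.le y hx0
        (fun x => (Matrix.of p ^ (m * j)) x y) _ (pow_nonneg hc2 j) ih x x'
      rw [show m * (j + 1) = m + m * j by ring, pow_add, Matrix.mul_apply, Matrix.mul_apply,
        pow_succ', ]
      exact this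
  have hlt : 1 - c ^ 2 < 1 := by nlinarith
  obtain ⟨j, hj⟩ := exists_pow_lt_of_lt_one hθ hlt
  refine ⟨m * j, fun k hk x => ?_⟩
  obtain ⟨b, rfl⟩ := Nat.exists_eq_add_of_le' hk
  have h1 := mono _ (pow_nonneg hc2 j) _ (iter j) b x
  have h2 : ∑ x', π x' * ((Matrix.of p ^ (b + m * j)) x y - (Matrix.of p ^ (b + m * j)) x' y)
      ≤ ∑ x', π x' * (1 - c ^ 2) ^ j :=
    Finset.sum_le_sum fun x' _ => mul_le_mul_of_nonneg_left (h1 x') (hπnn x')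
  simp only [mul_sub, Finset.sum_sub_distrib, ← Finset.sum_mul, hπsum, pow_stat p π hstat] at h2
  linarith

/-- coordinate indicator as a product factor -/
def gfac {S : Type*} [DecidableEq S] (c : ℕ) (a : S) (k : ℕ) (x : S) : ℝ :=
  if k = c then ind a x else 1

lemma gfac_prod {S : Type*} [DecidableEq S] (n : ℕ) (c : Fin n) (a : S) (z : Fin n → S) :
    ∏ k : Fin n, gfac c.1 a k (z k) = ind a (z c) := by
  rw [Finset.prod_eq_single c]
  · simp [gfac]
  · intro b _ hb
    have : b.1 ≠ c.1 := fun h => hb (Fin.ext h)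
    simp [gfac, this]
  · simp

/-- the indicator of an `(A·B)` triplet -/
def trip {S : Type*} [DecidableEq S] (A B : S) (n : ℕ) (i : Fin (n / 3)) (z : Fin n → S) : ℝ :=
  ind A (z (posA n i)) * ind B (z (posB n i))

lemma trip_mean {S : Type*} [Fintype S] [DecidableEq S] (p : S → S → ℝ)
    (hprow : ∀ x, ∑ y, p x y = 1) (π : S → ℝ)
    (hstat : ∀ y, ∑ x, π x * p x y = π y) (A B : S) (n : ℕ) (i : Fin (n / 3)) :
    ∑ z, chainLaw π p n z * trip A B n i z = π A * (∑ C, p A C * p C B) := by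
  have hi := i.isLt
  obtain ⟨l, hl⟩ : ∃ l, n = (l + 2) + 1 + 3 * i.1 := ⟨n - 3 - 3 * i.1, by omega⟩
  have e : ∑ z, chainLaw π p n z * trip A B n i z
      = wprod π p n (fun k x => gfac (3 * i.1) A k x * gfac (3 * i.1 + 2) B k x) := by
    unfold wprod
    apply Finset.sum_congr rfl
    intro z _
    rw [Finset.prod_mul_distrib]
    have h1 := gfac_prod n (posA n i) A z
    have h2 := gfac_prod n (posB n i) B z
    simp only [posA] at h1
    simp only [posB] at h2
    rw [h1, h2]
    rfl
  rw [e]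
  generalize i.1 = a at hl
  subst hl
  rw [wprod_skip]
  · simp only [pow_stat p π hstat]
    rw [wprod_triplet π p A B l]
    · rw [wprod_one (p B) p (hprow B) hprow, mul_one]
      intro k _ x
      simp only [gfac]
      rw [if_neg (by omega), if_neg (by omega), mul_one]
    · intro x; simp [gfac]
    · intro x
      simp only [gfac]
      rw [if_neg (by omega), if_neg (by omega), mul_one]
    · intro x; simp [gfac, add_comm]
  · intro k hk x
    simp only [gfac]
    rw [if_neg (by omega), if_neg (by omega), mul_one]

lemma trip_cov {S : Type*} [Fintype S] [DecidableEq S] (p : S → S → ℝ)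
    (hprow : ∀ x, ∑ y, p x y = 1) (π : S → ℝ)
    (hstat : ∀ y, ∑ x, π x * p x y = π y) (A B : S) (n : ℕ) (i j : Fin (n / 3)) (hij : i.1 < j.1) :
    ∑ z, chainLaw π p n z * (trip A B n i z * trip A B n j z)
      = π A * (∑ C, p A C * p C B) *
        ((Matrix.of p ^ (3 * (j.1 - i.1) - 2)) B A * (∑ C, p A C * p C B)) := by
  have hj := j.isLt
  obtain ⟨d, hd⟩ : ∃ d, j.1 = i.1 + 1 + d := ⟨j.1 - i.1 - 1, by omega⟩
  obtain ⟨l, hl⟩ : ∃ l, n = (((l + 2) + 1 + 3 * d) + 2) + 1 + 3 * i.1 :=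
    ⟨n - 3 - 3 * j.1, by omega⟩
  have e : ∑ z, chainLaw π p n z * (trip A B n i z * trip A B n j z)
      = wprod π p n (fun k x => gfac (3 * i.1) A k x * gfac (3 * i.1 + 2) B k x *
        (gfac (3 * j.1) A k x * gfac (3 * j.1 + 2) B k x)) := by
    unfold wprod
    apply Finset.sum_congr rfl
    intro z _
    rw [Finset.prod_mul_distrib, Finset.prod_mul_distrib, Finset.prod_mul_distrib]
    have h1 := gfac_prod n (posA n i) A z
    have h2 := gfac_prod n (posB n i) B z
    have h3 := gfac_prod n (posA n j) A z
    have h4 := gfac_prod n (posB n j) B z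
    simp only [posA] at h1 h3
    simp only [posB] at h2 h4
    rw [h1, h2, h3, h4]
    rfl
  rw [e]
  rw [show 3 * (j.1 - i.1) - 2 = 3 * d + 1 by omega, hd]
  generalize i.1 = a at hl
  subst hl
  rw [wprod_skip]
  · simp only [pow_stat p π hstat]
    rw [wprod_triplet π p A B]
    · congr 1
      rw [wprod_skip]
      · rw [wprod_triplet _ p A B l]
        · rw [wprod_one (p B) p (hprow B) hprow, mul_one]
          · rw [pow_succ', Matrix.mul_apply]
            rfl
          · intro k _ x
            simp only [gfac]
            rw [if_neg (by omega), if_neg (by omega), if_neg (by omega), if_neg (by omega)]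
            norm_num
        · intro x
          simp only [gfac]
          rw [if_neg (by omega), if_neg (by omega), if_pos (by omega), if_neg (by omega)]
          norm_num
        · intro x
          simp only [gfac]
          rw [if_neg (by omega), if_neg (by omega), if_neg (by omega), if_neg (by omega)]
          norm_num
        · intro x
          simp only [gfac]
          rw [if_neg (by omega), if_neg (by omega), if_neg (by omega), if_pos (by omega)]
          norm_num
      · intro k hk x
        simp only [gfac]
        rw [if_neg (by omega), if_neg (by omega), if_neg (by omega), if_neg (by omega)]
        norm_num
    · intro x
      simp only [gfac]
      rw [if_pos (by omega), if_neg (by omega), if_neg (by omega), if_neg (by omega)]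
      norm_num
    · intro x
      simp only [gfac]
      rw [if_neg (by omega), if_neg (by omega), if_neg (by omega), if_neg (by omega)]
      norm_num
    · intro x
      simp only [gfac]
      rw [if_neg (by omega), if_pos (by omega), if_neg (by omega), if_neg (by omega)]
      norm_num
  · intro k hk x
    simp only [gfac]
    rw [if_neg (by omega), if_neg (by omega), if_neg (by omega), if_neg (by omega)]
    norm_num

lemma ind_nonneg {S : Type*} [DecidableEq S] (a x : S) : 0 ≤ ind a x := by
  unfold ind; split_ifs <;> norm_num

lemma ind_le_one {S : Type*} [DecidableEq S] (a x : S) : ind a x ≤ 1 := by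
  unfold ind; split_ifs <;> norm_num

lemma trip_nonneg {S : Type*} [DecidableEq S] (A B : S) (n : ℕ) (i : Fin (n / 3)) (z : Fin n → S) :
    0 ≤ trip A B n i z := mul_nonneg (ind_nonneg _ _) (ind_nonneg _ _)

lemma trip_le_one {S : Type*} [DecidableEq S] (A B : S) (n : ℕ) (i : Fin (n / 3)) (z : Fin n → S) :
    trip A B n i z ≤ 1 := mul_le_one₀ (ind_le_one _ _) (ind_nonneg _ _) (ind_le_one _ _)

lemma near_count (N K : ℕ) (i : Fin N) :
    (∑ j : Fin N, if (j.1 ≤ i.1 + K ∧ i.1 ≤ j.1 + K) then (1 : ℝ) else 0) ≤ 2 * K + 1 := by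
  rw [Finset.sum_boole]
  have h : (univ.filter fun j : Fin N => (j.1 ≤ i.1 + K ∧ i.1 ≤ j.1 + K)).card
      ≤ (Finset.Icc (i.1 - K) (i.1 + K)).card := by
    apply Finset.card_le_card_of_injOn (fun j => j.1)
    · intro j hj
      simp only [Finset.coe_filter, Finset.mem_univ, true_and, Set.mem_ofPred_eq] at hj
      simp only [Finset.coe_Icc, Set.mem_Icc]
      omega
    · intro a _ b _ h; exact Fin.ext h
  rw [Nat.card_Icc] at h
  have h' : (univ.filter fun j : Fin N => (j.1 ≤ i.1 + K ∧ i.1 ≤ j.1 + K)).card ≤ 2 * K + 1 := by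
    omega
  exact_mod_cast h'

lemma V_var {S : Type*} [Fintype S] [DecidableEq S] (p : S → S → ℝ)
    (hpnn : ∀ x y, 0 ≤ p x y) (hprow : ∀ x, ∑ y, p x y = 1)
    (π : S → ℝ) (hπnn : ∀ x, 0 ≤ π x) (hπsum : ∑ x, π x = 1)
    (hstat : ∀ y, ∑ x, π x * p x y = π y)
    (haper : ∃ m : ℕ, ∀ x y, 0 < (Matrix.of p ^ m) x y) (A B : S) (β : ℝ)
    (hβ : β = π A * (∑ C, p A C * p C B)) (θ : ℝ) (hθ : 0 < θ) :
    ∃ K : ℕ, ∀ n : ℕ, ∑ z, chainLaw π p n z * ((∑ i, trip A B n i z) - (n / 3 : ℕ) * β) ^ 2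
      ≤ θ * ((n / 3 : ℕ) : ℝ) ^ 2 + (2 * K + 1) * ((n / 3 : ℕ) : ℝ) := by
  obtain ⟨K, hK⟩ := mixing p hpnn hprow π hπnn hπsum hstat haper A θ hθ
  refine ⟨K, fun n => ?_⟩
  set Q := ∑ C, p A C * p C B with hQ
  have hQ0 : 0 ≤ Q := Finset.sum_nonneg fun _ _ => mul_nonneg (hpnn _ _) (hpnn _ _)
  have hQ1 : Q ≤ 1 := by
    have h2 := pow_stoch p hpnn hprow 2
    have : Q = (Matrix.of p ^ 2) A B := by rw [sq, Matrix.mul_apply]; rfl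
    rw [this, ← h2.2 A]
    exact Finset.single_le_sum (fun z _ => h2.1 A z) (Finset.mem_univ B)
  have hπ1 : π A ≤ 1 := by
    rw [← hπsum]; exact Finset.single_le_sum (fun z _ => hπnn z) (Finset.mem_univ A)
  have hβ0 : 0 ≤ β := by rw [hβ]; exact mul_nonneg (hπnn A) hQ0
  have hβ1 : β ≤ 1 := by rw [hβ]; exact mul_le_one₀ hπ1 hQ0 hQ1
  have hsum1 := chainLaw_sum π p hπsum hprow n
  have hP := chainLaw_nonneg π p hπnn hpnn n
  have hfar : ∀ i j : Fin (n / 3), i.1 + K < j.1 →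
      ∑ z, chainLaw π p n z * (trip A B n i z * trip A B n j z) ≤ β ^ 2 + θ := by
    intro i j hij
    rw [trip_cov p hprow π hstat A B n i j (by omega), ← hQ, ← hβ]
    have h1 := hK (3 * (j.1 - i.1) - 2) (by omega) B
    calc β * ((Matrix.of p ^ (3 * (j.1 - i.1) - 2)) B A * Q)
        ≤ β * ((π A + θ) * Q) := by gcongr
      _ = β ^ 2 + θ * (β * Q) := by rw [hβ]; ring
      _ ≤ β ^ 2 + θ := by
        have : β * Q ≤ 1 := mul_le_one₀ hβ1 hQ0 hQ1
        nlinarith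
  have hcov : ∀ i j : Fin (n / 3),
      ∑ z, chainLaw π p n z * (trip A B n i z * trip A B n j z) - β ^ 2
      ≤ θ + if (j.1 ≤ i.1 + K ∧ i.1 ≤ j.1 + K) then (1 : ℝ) else 0 := by
    intro i j
    split_ifs with h
    · have : ∑ z, chainLaw π p n z * (trip A B n i z * trip A B n j z) ≤ 1 := by
        rw [← hsum1]
        apply Finset.sum_le_sum
        intro z _
        apply mul_le_of_le_one_right (hP z)
        exact mul_le_one₀ (trip_le_one _ _ _ _ _) (trip_nonneg _ _ _ _ _) (trip_le_one _ _ _ _ _)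
      nlinarith [sq_nonneg β]
    · by_cases h2 : i.1 + K < j.1
      · linarith [hfar i j h2]
      · have := hfar j i (by omega)
        simp only [mul_comm (trip A B n i _)]
        linarith
  have expand : ∑ z, chainLaw π p n z * ((∑ i, trip A B n i z) - (n / 3 : ℕ) * β) ^ 2
      = ∑ i, ∑ j, (∑ z, chainLaw π p n z * (trip A B n i z * trip A B n j z) - β ^ 2) := by
    have hm : ∑ z, chainLaw π p n z * (∑ i, trip A B n i z) = (n / 3 : ℕ) * β := by
      simp only [Finset.mul_sum]
      rw [Finset.sum_comm]
      simp only [trip_mean p hprow π hstat, ← hQ, ← hβ]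
      simp
    have hs : ∑ z, chainLaw π p n z * (∑ i, trip A B n i z) ^ 2
        = ∑ i, ∑ j, ∑ z, chainLaw π p n z * (trip A B n i z * trip A B n j z) := by
      have h1 : ∀ z, chainLaw π p n z * (∑ i, trip A B n i z) ^ 2
          = ∑ i, ∑ j, chainLaw π p n z * (trip A B n i z * trip A B n j z) := by
        intro z
        rw [sq, Finset.sum_mul_sum, Finset.mul_sum]
        exact Finset.sum_congr rfl fun i _ => Finset.mul_sum _ _ _
      rw [Finset.sum_congr rfl fun z _ => h1 z, Finset.sum_comm]
      apply Finset.sum_congr rfl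
      intro i _
      rw [Finset.sum_comm]
    simp only [Finset.sum_sub_distrib, ← hs]
    calc _ = ∑ z, (chainLaw π p n z * (∑ i, trip A B n i z) ^ 2
          - 2 * ((n / 3 : ℕ) * β) * (chainLaw π p n z * (∑ i, trip A B n i z))
          + ((n / 3 : ℕ) * β) ^ 2 * chainLaw π p n z) := by
          apply Finset.sum_congr rfl; intro z _; ring
      _ = _ := by
          rw [Finset.sum_add_distrib, Finset.sum_sub_distrib, ← Finset.mul_sum, ← Finset.mul_sum,
            hm, hsum1]
          simp
          ring
  rw [expand]
  calc _ ≤ ∑ i : Fin (n / 3), ∑ j : Fin (n / 3),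
        (θ + if (j.1 ≤ i.1 + K ∧ i.1 ≤ j.1 + K) then (1 : ℝ) else 0) :=
        Finset.sum_le_sum fun i _ => Finset.sum_le_sum fun j _ => hcov i j
    _ ≤ ∑ i : Fin (n / 3), (((n / 3 : ℕ) : ℝ) * θ + (2 * K + 1)) := by
        apply Finset.sum_le_sum
        intro i _
        rw [Finset.sum_add_distrib]
        have := near_count (n / 3) K i
        simp only [Finset.sum_const, Finset.card_univ, Fintype.card_fin, nsmul_eq_mul]
        linarith
    _ = _ := by simp; ring

lemma V_large {S : Type*} [Fintype S] [DecidableEq S] (p : S → S → ℝ)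
    (hpnn : ∀ x y, 0 ≤ p x y) (hprow : ∀ x, ∑ y, p x y = 1)
    (π : S → ℝ) (hπnn : ∀ x, 0 ≤ π x) (hπsum : ∑ x, π x = 1)
    (hstat : ∀ y, ∑ x, π x * p x y = π y)
    (haper : ∃ m : ℕ, ∀ x y, 0 < (Matrix.of p ^ m) x y) (A B : S) (α : ℝ)
    (hα : α = (1 / 3) * (π A * (∑ C, p A C * p C B))) (hα0 : 0 < α) :
    ∀ᶠ n : ℕ in Filter.atTop, 1 / 2 ≤
      ∑ z, if α * n / 2 ≤ ∑ i, trip A B n i z then chainLaw π p n z else 0 := by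
  obtain ⟨K, hK⟩ := V_var p hpnn hprow π hπnn hπsum hstat haper A B (3 * α)
    (by rw [hα]; ring) (α ^ 2 / 8) (by positivity)
  have ev1 : ∀ᶠ n : ℕ in Filter.atTop, 64 * (2 * K + 1) / (3 * α ^ 2) ≤ (n : ℝ) :=
    tendsto_natCast_atTop_atTop.eventually_ge_atTop _
  filter_upwards [ev1, Filter.eventually_ge_atTop 12] with n hn1 hn2
  have hn2' : (12 : ℝ) ≤ n := by exact_mod_cast hn2
  have hv := hK n
  have hsum1 := chainLaw_sum π p hπsum hprow n
  have hP := chainLaw_nonneg π p hπnn hpnn n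
  set N : ℝ := ((n / 3 : ℕ) : ℝ) with hN
  have hN1 : N ≤ n / 3 := by rw [hN]; exact Nat.cast_div_le
  have hN2 : (n : ℝ) / 3 - 1 ≤ N := by
    have : n ≤ 3 * (n / 3) + 2 := by omega
    have : (n : ℝ) ≤ 3 * N + 2 := by rw [hN]; exact_mod_cast this
    linarith
  have hN0 : 0 ≤ N := by rw [hN]; positivity
  rw [div_le_iff₀ (by positivity)] at hn1
  have hbound : α ^ 2 / 8 * N ^ 2 + (2 * K + 1) * N ≤ (α * n / 4) ^ 2 / 2 := by
    have h1 : N ^ 2 ≤ (n / 3 : ℝ) ^ 2 := pow_le_pow_left₀ hN0 hN1 2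
    have h2 : (2 * (K : ℝ) + 1) * N ≤ (2 * K + 1) * (n / 3) := by gcongr
    have h3 : α ^ 2 / 8 * N ^ 2 ≤ α ^ 2 / 8 * (n / 3 : ℝ) ^ 2 := by gcongr
    nlinarith [sq_nonneg (α * n)]
  have hcheb : (α * n / 4) ^ 2 * (∑ z, if α * n / 2 ≤ ∑ i, trip A B n i z then 0 else
      chainLaw π p n z) ≤ (α * n / 4) ^ 2 / 2 := by
    refine le_trans ?_ (hv.trans hbound)
    rw [Finset.mul_sum]
    apply Finset.sum_le_sum
    intro z _
    split_ifs with h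
    · rw [mul_zero]; exact mul_nonneg (hP z) (sq_nonneg _)
    · rw [mul_comm]
      apply mul_le_mul_of_nonneg_left _ (hP z)
      rw [← neg_sq ((∑ i, trip A B n i z) - _)]
      apply pow_le_pow_left₀ (by positivity)
      push Not at h
      nlinarith
  have hpos : 0 < (α * n / 4) ^ 2 := by positivity
  have h2 : (∑ z, if α * n / 2 ≤ ∑ i, trip A B n i z then 0 else chainLaw π p n z) ≤ 1 / 2 := by
    apply le_of_mul_le_mul_left _ hpos
    linarith
  have h3 : (∑ z, if α * n / 2 ≤ ∑ i, trip A B n i z then chainLaw π p n z else 0) +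
      (∑ z, if α * n / 2 ≤ ∑ i, trip A B n i z then 0 else chainLaw π p n z) = 1 := by
    rw [← hsum1, ← Finset.sum_add_distrib]
    apply Finset.sum_congr rfl
    intro z _
    split_ifs <;> simp
  linarith
/-! ### Part 3: the transformation and its transport identity -/

/-- the `(A·B)` triplets -/
def tset {S : Type*} [DecidableEq S] (A B : S) (n : ℕ) (z : Fin n → S) : Finset (Fin (n / 3)) :=
  univ.filter fun i => z (posA n i) = A ∧ z (posB n i) = B
/-- the `(A D B)` triplets -/
def iset {S : Type*} [DecidableEq S] (A B D : S) (n : ℕ) (z : Fin n → S) : Finset (Fin (n / 3)) :=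
  univ.filter fun i => z (posA n i) = A ∧ z (posB n i) = B ∧ z (posM n i) = D
/-- the `(A·B)` triplets whose middle letter is not `D` -/
def jset {S : Type*} [DecidableEq S] (A B D : S) (n : ℕ) (z : Fin n → S) : Finset (Fin (n / 3)) :=
  univ.filter fun i => z (posA n i) = A ∧ z (posB n i) = B ∧ z (posM n i) ≠ D

section
variable {S : Type*} [DecidableEq S] (A B D : S) (n : ℕ)

lemma posA_ne_posM (i j : Fin (n / 3)) : posA n i ≠ posM n j := by
  intro h; have := congrArg Fin.val h; simp only [posA, posM] at this; omega

lemma posB_ne_posM (i j : Fin (n / 3)) : posB n i ≠ posM n j := by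
  intro h; have := congrArg Fin.val h; simp only [posB, posM] at this; omega

lemma posM_inj {i j : Fin (n / 3)} (h : posM n i = posM n j) : i = j := by
  have := congrArg Fin.val h; simp only [posM] at this; exact Fin.ext (by omega)

lemma tset_update (z : Fin n → S) (i : Fin (n / 3)) (d : S) :
    tset A B n (Function.update z (posM n i) d) = tset A B n z := by
  simp [tset, Function.update_of_ne (posA_ne_posM n _ _),
    Function.update_of_ne (posB_ne_posM n _ _)]

lemma iset_update_D (z : Fin n → S) (i : Fin (n / 3)) (hi : i ∈ tset A B n z) :
    iset A B D n (Function.update z (posM n i) D) = insert i (iset A B D n z) := by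
  ext j
  simp only [tset, Finset.mem_filter, Finset.mem_univ, true_and] at hi
  simp only [iset, Finset.mem_filter, Finset.mem_univ, true_and, Finset.mem_insert,
    Function.update_of_ne (posA_ne_posM n _ _), Function.update_of_ne (posB_ne_posM n _ _)]
  by_cases h : j = i
  · subst h; simp [hi]
  · rw [Function.update_of_ne (fun h' => h (posM_inj n h'))]
    simp [h]

lemma iset_update_ne (z : Fin n → S) (i : Fin (n / 3)) (d : S) (hd : d ≠ D) :
    iset A B D n (Function.update z (posM n i) d) = (iset A B D n z).erase i := by
  ext j
  simp only [iset, Finset.mem_filter, Finset.mem_univ, true_and, Finset.mem_erase,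
    Function.update_of_ne (posA_ne_posM n _ _), Function.update_of_ne (posB_ne_posM n _ _)]
  by_cases h : j = i
  · subst h; simp [hd]
  · rw [Function.update_of_ne (fun h' => h (posM_inj n h'))]
    simp [h]

lemma card_tset (z : Fin n → S) :
    (jset A B D n z).card + (iset A B D n z).card = (tset A B n z).card := by
  have h1 : iset A B D n z = (tset A B n z).filter (fun i => z (posM n i) = D) := by
    ext j; simp [iset, tset, and_assoc]
  have h2 : jset A B D n z = (tset A B n z).filter (fun i => ¬ z (posM n i) = D) := by
    ext j; simp [jset, tset, and_assoc]
  rw [h1, h2, add_comm]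
  exact Finset.card_filter_add_card_filter_not _

lemma kernel_apply [Fintype S] (f : (Fin n → S) → ℝ) (z : Fin n → S)
    (h : (jset A B D n z).Nonempty) :
    ((jset A B D n z).card : ℝ) * ∑ z', kernelR A B D n z z' * f z'
      = ∑ i ∈ jset A B D n z, f (Function.update z (posM n i) D) := by
  classical
  have hJ : ∀ z', kernelR A B D n z z' =
      (((jset A B D n z).filter fun i => Function.update z (posM n i) D = z').card : ℝ) /
        (jset A B D n z).card := by
    intro z'
    unfold kernelR
    simp only
    rw [if_pos (by convert h; ext i; simp [jset])]
    congr!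
    all_goals (ext i; simp [jset])
  have hc : ((jset A B D n z).card : ℝ) ≠ 0 := by
    have := h.card_pos
    positivity
  simp only [hJ]
  rw [Finset.mul_sum]
  have h2 : ∀ z', ((jset A B D n z).card : ℝ) *
      ((((jset A B D n z).filter fun i => Function.update z (posM n i) D = z').card : ℝ) /
        (jset A B D n z).card * f z')
      = ∑ i ∈ jset A B D n z, if Function.update z (posM n i) D = z' then f z' else 0 := by
    intro z'
    rw [← Finset.sum_filter, Finset.sum_const, nsmul_eq_mul]
    field_simp
  rw [Finset.sum_congr rfl fun z' _ => h2 z', Finset.sum_comm]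
  apply Finset.sum_congr rfl
  intro i _
  simp

lemma detailed_balance (π : S → ℝ) (p : S → S → ℝ) (z : Fin n → S) (i : Fin (n / 3))
    (hi : i ∈ tset A B n z) (d : S) :
    chainLaw π p n (Function.update z (posM n i) d) * (p A D * p D B)
      = chainLaw π p n (Function.update z (posM n i) D) * (p A d * p d B) := by
  simp only [tset, Finset.mem_filter, Finset.mem_univ, true_and] at hi
  have hlt := i.isLt
  have hn : 0 < n := by omega
  unfold chainLaw
  rw [dif_pos hn, dif_pos hn]
  have h0 : ∀ d, Function.update z (posM n i) d ⟨0, hn⟩ = z ⟨0, hn⟩ := by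
    intro d
    apply Function.update_of_ne
    intro h; have := congrArg Fin.val h; simp [posM] at this
  rw [h0, h0]
  let k0 : Fin (n - 1) := ⟨3 * i.1, by omega⟩
  let k1 : Fin (n - 1) := ⟨3 * i.1 + 1, by omega⟩
  have hk : k1 ∈ (univ : Finset (Fin (n - 1))).erase k0 := by
    simp [k0, k1]
  have key : ∀ d, (∏ k : Fin (n - 1),
        p (Function.update z (posM n i) d ⟨k.1, by have := k.isLt; omega⟩)
          (Function.update z (posM n i) d ⟨k.1 + 1, by have := k.isLt; omega⟩))
      = p A d * (p d B * ∏ k ∈ ((univ : Finset (Fin (n - 1))).erase k0).erase k1,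
        p (z ⟨k.1, by have := k.isLt; omega⟩) (z ⟨k.1 + 1, by have := k.isLt; omega⟩)) := by
    intro d
    rw [← Finset.mul_prod_erase _ _ (Finset.mem_univ k0), ← Finset.mul_prod_erase _ _ hk]
    congr 1
    · congr 1
      · rw [Function.update_of_ne]
        · exact hi.1
        · exact posA_ne_posM n i i
      · exact Function.update_self (posM n i) d z
    congr 1
    · congr 1
      · exact Function.update_self (posM n i) d z
      · rw [Function.update_of_ne]
        · exact hi.2
        · exact posB_ne_posM n i i
    · apply Finset.prod_congr rfl
      intro k hk
      simp only [Finset.mem_erase, Finset.mem_univ, and_true, k0, k1, ne_eq, Fin.ext_iff] at hk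
      rw [Function.update_of_ne, Function.update_of_ne]
      · intro h; have := congrArg Fin.val h; simp only [posM] at this; omega
      · intro h; have := congrArg Fin.val h; simp only [posM] at this; omega
  rw [key, key]
  ring

/-- the level set `V = v`, `U = u` -/
def level [Fintype S] (v u : ℕ) : Finset (Fin n → S) :=
  univ.filter fun z => (tset A B n z).card = v ∧ (iset A B D n z).card = u

lemma transport_i [Fintype S] (π : S → ℝ) (p : S → S → ℝ) (f : (Fin n → S) → ℝ) (v u : ℕ)
    (i : Fin (n / 3)) :
    ∑ z ∈ (level A B D n v u).filter (fun z => i ∈ jset A B D n z),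
        chainLaw π p n z * f (Function.update z (posM n i) D) * (p A D * p D B)
      = ∑ z ∈ (level A B D n v (u + 1)).filter (fun z => i ∈ iset A B D n z),
        chainLaw π p n z * f z * ((∑ C, p A C * p C B) - p A D * p D B) := by
  have e : (∑ C, p A C * p C B) - p A D * p D B = ∑ d ∈ univ.erase D, p A d * p d B := by
    rw [← Finset.add_sum_erase _ _ (Finset.mem_univ D)]; ring
  rw [e]
  simp only [Finset.mul_sum]
  rw [← Finset.sum_product']
  refine Finset.sum_bij' (fun z _ => (Function.update z (posM n i) D, z (posM n i)))
    (fun x _ => Function.update x.1 (posM n i) x.2) ?_ ?_ ?_ ?_ ?_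
  · intro z hz
    simp only [Finset.mem_filter, level, Finset.mem_univ, true_and, jset] at hz
    obtain ⟨⟨hv, hu⟩, hA, hB, hD⟩ := hz
    have hit : i ∈ tset A B n z := by simp [tset, hA, hB]
    have hii : i ∉ iset A B D n z := by simp [iset, hD]
    simp only [Finset.mem_product, Finset.mem_filter, level, Finset.mem_univ, true_and,
      Finset.mem_erase, and_true]
    rw [tset_update, iset_update_D _ _ _ _ _ _ hit, Finset.card_insert_of_notMem hii]
    exact ⟨⟨⟨hv, by omega⟩, Finset.mem_insert_self _ _⟩, hD⟩
  · intro x hx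
    simp only [Finset.mem_product, Finset.mem_filter, level, Finset.mem_univ, true_and,
      Finset.mem_erase, and_true] at hx
    obtain ⟨⟨⟨hv, hu⟩, hi⟩, hD⟩ := hx
    simp only [Finset.mem_filter, level, Finset.mem_univ, true_and]
    rw [tset_update, iset_update_ne _ _ _ _ _ _ _ hD, Finset.card_erase_of_mem hi]
    refine ⟨⟨hv, by omega⟩, ?_⟩
    simp only [iset, Finset.mem_filter, Finset.mem_univ, true_and] at hi
    simp only [jset, Finset.mem_filter, Finset.mem_univ, true_and, Function.update_self,
      Function.update_of_ne (posA_ne_posM n _ _), Function.update_of_ne (posB_ne_posM n _ _)]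
    exact ⟨hi.1, hi.2.1, hD⟩
  · intro z hz
    simp
  · intro x hx
    simp only [Finset.mem_product, Finset.mem_filter, level, Finset.mem_univ, true_and,
      Finset.mem_erase, and_true, iset] at hx
    have : x.1 (posM n i) = D := hx.1.2.2.2
    ext1
    · simp only [Function.update_idem]
      rw [← this, Function.update_eq_self]
    · simp
  · intro z hz
    simp only [Finset.mem_filter, level, Finset.mem_univ, true_and, jset] at hz
    have hit : i ∈ tset A B n z := by simp [tset, hz.2.1, hz.2.2.1]
    have := detailed_balance A B D n π p z i hit (z (posM n i))
    rw [Function.update_eq_self] at this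
    simp only
    calc _ = (chainLaw π p n z * (p A D * p D B)) * f (Function.update z (posM n i) D) := by ring
      _ = _ := by rw [this]; ring

lemma transport [Fintype S] (π : S → ℝ) (p : S → S → ℝ) (q : ℝ)
    (hQ : 0 < ∑ C, p A C * p C B) (hq : q = p A D * p D B / ∑ C, p A C * p C B)
    (f : (Fin n → S) → ℝ) (v u : ℕ) (huv : u < v) :
    (∑ z ∈ level A B D n v u, chainLaw π p n z * ∑ z', kernelR A B D n z z' * f z')
        * ((v : ℝ) - u) * q
      = (∑ z ∈ level A B D n v (u + 1), chainLaw π p n z * f z) * (u + 1) * (1 - q) := by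
  set Q := ∑ C, p A C * p C B with hQdef
  set w := p A D * p D B with hw
  have h1 : (∑ z ∈ level A B D n v u, chainLaw π p n z * ∑ z', kernelR A B D n z z' * f z')
        * ((v : ℝ) - u) = ∑ z ∈ level A B D n v u, ∑ i ∈ jset A B D n z,
          chainLaw π p n z * f (Function.update z (posM n i) D) := by
    rw [Finset.sum_mul]
    apply Finset.sum_congr rfl
    intro z hz
    simp only [level, Finset.mem_filter, Finset.mem_univ, true_and] at hz
    have hc := card_tset A B D n z
    have hcj : ((jset A B D n z).card : ℝ) = (v : ℝ) - u := by
      rw [← hz.1, ← hz.2, ← hc]; push_cast; ring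
    have hne : (jset A B D n z).Nonempty := by
      rw [← Finset.card_pos]; omega
    rw [← hcj, ← Finset.mul_sum, ← kernel_apply A B D n f z hne]
    ring
  have h2 : (∑ z ∈ level A B D n v u, ∑ i ∈ jset A B D n z,
          chainLaw π p n z * f (Function.update z (posM n i) D)) * w
      = (∑ z ∈ level A B D n v (u + 1), ∑ i ∈ iset A B D n z,
          chainLaw π p n z * f z) * (Q - w) := by
    have a : (∑ z ∈ level A B D n v u, ∑ i ∈ jset A B D n z,
          chainLaw π p n z * f (Function.update z (posM n i) D)) * w
        = ∑ i, ∑ z ∈ (level A B D n v u).filter (fun z => i ∈ jset A B D n z),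
        chainLaw π p n z * f (Function.update z (posM n i) D) * w := by
      simp only [Finset.sum_filter]
      rw [Finset.sum_comm, Finset.sum_mul]
      apply Finset.sum_congr rfl
      intro z _
      rw [Finset.sum_mul, ← Finset.sum_filter]
      congr 1
      ext i; simp
    have b : (∑ z ∈ level A B D n v (u + 1), ∑ i ∈ iset A B D n z,
          chainLaw π p n z * f z) * (Q - w)
        = ∑ i, ∑ z ∈ (level A B D n v (u + 1)).filter (fun z => i ∈ iset A B D n z),
        chainLaw π p n z * f z * (Q - w) := by
      simp only [Finset.sum_filter]
      rw [Finset.sum_comm, Finset.sum_mul]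
      apply Finset.sum_congr rfl
      intro z _
      rw [Finset.sum_mul, ← Finset.sum_filter]
      congr 1
      ext i; simp
    rw [a, b]
    exact Finset.sum_congr rfl fun i _ => transport_i A B D n π p f v u i
  have h3 : (∑ z ∈ level A B D n v (u + 1), ∑ i ∈ iset A B D n z, chainLaw π p n z * f z)
      = (∑ z ∈ level A B D n v (u + 1), chainLaw π p n z * f z) * (u + 1) := by
    rw [Finset.sum_mul]
    apply Finset.sum_congr rfl
    intro z hz
    simp only [level, Finset.mem_filter, Finset.mem_univ, true_and] at hz
    rw [Finset.sum_const, nsmul_eq_mul, hz.2]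
    push_cast; ring
  rw [h1, ← h3, hq]
  have hw2 : 1 - w / Q = (Q - w) / Q := by field_simp
  rw [hw2, mul_div_assoc', mul_div_assoc', h2]

end
/-! ### Part 4: binomial local lower bound -/

/-- binomial pmf -/
def bpm (v : ℕ) (q : ℝ) (u : ℕ) : ℝ := (v.choose u : ℝ) * q ^ u * (1 - q) ^ (v - u)

lemma bpm_eq (v : ℕ) (q : ℝ) (u : ℕ) : bpm v q u = (bernsteinPolynomial ℝ v u).eval q := by
  simp [bpm, bernsteinPolynomial]

lemma bpm_pos {v u : ℕ} {q : ℝ} (h0 : 0 < q) (h1 : q < 1) (hu : u ≤ v) : 0 < bpm v q u := by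
  have := Nat.choose_pos hu
  have : 0 < 1 - q := by linarith
  unfold bpm; positivity

lemma bpm_sum (v : ℕ) (q : ℝ) : ∑ u ∈ range (v + 1), bpm v q u = 1 := by
  have := congrArg (Polynomial.eval q) (bernsteinPolynomial.sum ℝ v)
  simpa [Polynomial.eval_finsetSum, bpm_eq] using this

lemma bpm_var (v : ℕ) (q : ℝ) :
    ∑ u ∈ range (v + 1), ((u : ℝ) - v * q) ^ 2 * bpm v q u = v * (q * (1 - q)) := by
  have := congrArg (Polynomial.eval q) (bernsteinPolynomial.variance ℝ v)
  simp only [Polynomial.eval_finsetSum, Polynomial.eval_mul, Polynomial.eval_pow,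
    Polynomial.eval_sub, Polynomial.eval_X, Polynomial.eval_natCast,
    Polynomial.eval_one, nsmul_eq_mul, ← bpm_eq] at this
  rw [← mul_assoc, ← this]
  apply Finset.sum_congr rfl
  intro u _
  ring

lemma bpm_rec {v u : ℕ} (q : ℝ) (hu : u < v) :
    bpm v q u * ((v : ℝ) - u) * q = bpm v q (u + 1) * (u + 1) * (1 - q) := by
  have h := Nat.choose_succ_right_eq v u
  have h' : (v.choose (u + 1) : ℝ) * (u + 1) = v.choose u * ((v : ℝ) - u) := by
    rw [← Nat.cast_sub hu.le]; exact_mod_cast h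
  have e : v - u = (v - (u + 1)) + 1 := by omega
  unfold bpm
  rw [e]
  calc _ = (v.choose u * ((v : ℝ) - u)) * q ^ (u + 1) * (1 - q) ^ (v - (u + 1) + 1) := by ring
    _ = _ := by rw [← h']; ring

lemma bpm_symm {v u : ℕ} (q : ℝ) (hu : u ≤ v) : bpm v q u = bpm v (1 - q) (v - u) := by
  unfold bpm
  rw [Nat.choose_symm hu, Nat.sub_sub_self hu]
  ring

/-- the mode -/
lemma bpm_mode {v : ℕ} {q : ℝ} (h0 : 0 < q) (h1 : q < 1) (hv : 0 < v) :
    ∃ m ≤ v, |(m : ℝ) - v * q| ≤ 1 ∧ 3 / 4 ≤ (2 * √v + 1) * bpm v q m := by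
  obtain ⟨m, hm, hmax⟩ := Finset.exists_max_image (range (v + 1)) (bpm v q) (by simp)
  rw [Finset.mem_range] at hm
  have hmv : m ≤ v := by omega
  have hpm := bpm_pos h0 h1 hmv
  refine ⟨m, hmv, ?_, ?_⟩
  · rw [abs_le]
    constructor
    · rcases hmv.eq_or_lt with h | h
      · subst h
        nlinarith [(Nat.cast_pos (α := ℝ)).2 hv]
      · have hr := bpm_rec q h
        have hle := hmax (m + 1) (by simp; omega)
        have : bpm v q m * ((v : ℝ) - m) * q ≤ bpm v q m * ((m + 1) * (1 - q)) := by
          rw [hr, mul_assoc]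
          apply mul_le_mul_of_nonneg_right hle
          have : 0 < 1 - q := by linarith
          positivity
        rw [mul_assoc] at this
        have := le_of_mul_le_mul_left this hpm
        nlinarith
    · rcases Nat.eq_zero_or_pos m with h | h
      · subst h
        have : (0 : ℝ) ≤ v * q := by positivity
        push_cast; linarith
      · obtain ⟨k, rfl⟩ : ∃ k, m = k + 1 := ⟨m - 1, by omega⟩
        have hr := bpm_rec q (show k < v by omega)
        have hle := hmax k (by simp; omega)
        have : bpm v q (k + 1) * ((k + 1) * (1 - q)) ≤ bpm v q (k + 1) * (((v : ℝ) - k) * q) := by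
          rw [← mul_assoc, ← hr, mul_assoc]
          apply mul_le_mul_of_nonneg_right hle
          have : (k : ℝ) + 1 ≤ v := by exact_mod_cast hmv
          apply mul_nonneg _ h0.le
          linarith
        have := le_of_mul_le_mul_left this hpm
        push_cast
        nlinarith
  · have hv' : (0 : ℝ) < v := by exact_mod_cast hv
    set W := (range (v + 1)).filter (fun u : ℕ => |(u : ℝ) - v * q| ≤ √v) with hW
    have hsW : 3 / 4 ≤ ∑ u ∈ W, bpm v q u := by
      have hs := bpm_sum v q
      have hvar := bpm_var v q
      rw [← Finset.sum_filter_add_sum_filter_not _ (fun u : ℕ => |(u : ℝ) - v * q| ≤ √v)] at hs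
      have h4 : (v : ℝ) * ∑ u ∈ (range (v + 1)).filter (fun u : ℕ => ¬ |(u : ℝ) - v * q| ≤ √v),
          bpm v q u ≤ v * (q * (1 - q)) := by
        rw [← hvar, Finset.mul_sum]
        calc _ ≤ ∑ u ∈ (range (v + 1)).filter (fun u : ℕ => ¬ |(u : ℝ) - v * q| ≤ √v),
              ((u : ℝ) - v * q) ^ 2 * bpm v q u := by
              apply Finset.sum_le_sum
              intro u hu
              rw [Finset.mem_filter, Finset.mem_range, not_le] at hu
              apply mul_le_mul_of_nonneg_right _ (bpm_pos h0 h1 (by omega)).le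
              rw [← sq_abs, ← Real.sq_sqrt hv'.le]
              exact pow_le_pow_left₀ (by positivity) (by rw [Real.sq_sqrt hv'.le]; exact hu.2.le) 2
          _ ≤ _ := by
              apply Finset.sum_le_sum_of_subset_of_nonneg (Finset.filter_subset _ _)
              intro u hu _
              rw [Finset.mem_range] at hu
              exact mul_nonneg (sq_nonneg _) (bpm_pos h0 h1 (by omega)).le
      have h5 := le_of_mul_le_mul_left h4 hv'
      nlinarith [sq_nonneg (2 * q - 1)]
    have hcard : (W.card : ℝ) ≤ 2 * √v + 1 := by
      have hsub : W ⊆ Finset.Icc ⌈(v * q - √v : ℝ)⌉₊ ⌊(v * q + √v : ℝ)⌋₊ := by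
        intro u hu
        rw [hW, Finset.mem_filter, abs_le] at hu
        rw [Finset.mem_Icc]
        constructor
        · apply Nat.ceil_le.2; linarith
        · apply Nat.le_floor; linarith
      have hc := Finset.card_le_card hsub
      rw [Nat.card_Icc] at hc
      have hpos : (0 : ℝ) ≤ v * q + √v := by positivity
      have h6 := Nat.floor_le hpos
      have h7 := Nat.le_ceil (v * q - √v : ℝ)
      have : W.card = 0 ∨ W.card + ⌈(v * q - √v : ℝ)⌉₊ ≤ ⌊(v * q + √v : ℝ)⌋₊ + 1 := by omega
      rcases this with h | h
      · rw [h]; push_cast; positivity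
      · have h' : (W.card : ℝ) + ⌈(v * q - √v : ℝ)⌉₊ ≤ ⌊(v * q + √v : ℝ)⌋₊ + 1 := by
          exact_mod_cast h
        linarith
    calc 3 / 4 ≤ ∑ u ∈ W, bpm v q u := hsW
      _ ≤ ∑ u ∈ W, bpm v q m := Finset.sum_le_sum fun u hu => hmax u (Finset.filter_subset _ _ hu)
      _ = W.card * bpm v q m := by simp
      _ ≤ _ := mul_le_mul_of_nonneg_right hcard hpm.le

lemma bpm_up {v m u : ℕ} {q : ℝ} (h0 : 0 < q) (h1 : q < 1)
    (hv : 8 + 1 / (2 * (1 - q)) ≤ √v) (hmu : m ≤ u) (huv : u ≤ v)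
    (hm : v * q - 1 ≤ m) (hu : (u : ℝ) ≤ v * q + √v / 4) :
    bpm v q m * Real.exp (-(1 / (8 * (q * (1 - q))))) ≤ bpm v q u := by
  have hq1 : 0 < 1 - q := by linarith
  have hc : 0 < 1 / (2 * (1 - q)) := by positivity
  set w := √(v : ℝ) with hw
  have hwpos : 0 < w := by linarith
  have hww : (v : ℝ) = w * w := (Real.mul_self_sqrt (by positivity)).symm
  set y := 1 / (2 * (q * (1 - q)) * (w + 8)) with hy
  have hypos : 0 < y := by positivity
  have hyx : w / 4 ≤ y * (v * (q * (1 - q)) - w / 4 * q) := by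
    have : y * (v * (q * (1 - q)) - w / 4 * q)
        = w * (w - 1 / (2 * (1 - q)) / 2) / (2 * (w + 8)) := by
      rw [hy, hww]; field_simp; ring
    rw [this, div_le_div_iff₀ (by norm_num) (by positivity)]
    nlinarith
  have step : ∀ k : ℕ, k + 1 ≤ v → ((k : ℝ) + 1 ≤ v * q + w / 4) →
      bpm v q k * Real.exp (-y) ≤ bpm v q (k + 1) := by
    intro k hk hk2
    have hr := bpm_rec q (show k < v by omega)
    have hpk := bpm_pos h0 h1 (show k ≤ v by omega)
    have hpk1 := bpm_pos h0 h1 hk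
    have hvk : (0 : ℝ) < v - k := by
      have : (k : ℝ) + 1 ≤ v := by exact_mod_cast hk
      linarith
    have h2 : ((k : ℝ) + 1) * (1 - q) ≤ (1 + y) * (((v : ℝ) - k) * q) := by
      have : (1 + y) * ((v * (1 - q) - w / 4) * q) ≤ (1 + y) * (((v : ℝ) - k) * q) := by
        apply mul_le_mul_of_nonneg_left _ (by positivity)
        apply mul_le_mul_of_nonneg_right _ h0.le
        linarith
      have h3 : ((k : ℝ) + 1) * (1 - q) ≤ (v * q + w / 4) * (1 - q) :=
        mul_le_mul_of_nonneg_right hk2 hq1.le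
      nlinarith
    have h3 : bpm v q k ≤ bpm v q (k + 1) * (1 + y) := by
      have hp : 0 < ((v : ℝ) - k) * q := by positivity
      apply le_of_mul_le_mul_right _ hp
      calc bpm v q k * (((v : ℝ) - k) * q) = bpm v q (k + 1) * ((k + 1) * (1 - q)) := by
            rw [← mul_assoc, hr, mul_assoc]
        _ ≤ bpm v q (k + 1) * ((1 + y) * (((v : ℝ) - k) * q)) :=
            mul_le_mul_of_nonneg_left h2 hpk1.le
        _ = _ := by ring
    have h4 : 1 + y ≤ Real.exp y := by linarith [Real.add_one_le_exp y]
    calc bpm v q k * Real.exp (-y) ≤ bpm v q (k + 1) * Real.exp y * Real.exp (-y) := by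
          apply mul_le_mul_of_nonneg_right _ (Real.exp_pos _).le
          exact h3.trans (mul_le_mul_of_nonneg_left h4 hpk1.le)
      _ = bpm v q (k + 1) := by rw [mul_assoc, ← Real.exp_add]; simp
  have ind : ∀ j : ℕ, m + j ≤ v → ((m : ℝ) + j ≤ v * q + w / 4) →
      bpm v q m * Real.exp (-y * j) ≤ bpm v q (m + j) := by
    intro j
    induction j with
    | zero => intro _ _; simp
    | succ j ih =>
      intro ha hb
      push_cast at hb
      have h5 := ih (by omega) (by linarith)
      have h6 := step (m + j) (by omega) (by push_cast; linarith)
      calc bpm v q m * Real.exp (-y * (j + 1 : ℕ))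
          = bpm v q m * Real.exp (-y * j) * Real.exp (-y) := by
            rw [mul_assoc, ← Real.exp_add]; congr 2; push_cast; ring
        _ ≤ bpm v q (m + j) * Real.exp (-y) :=
            mul_le_mul_of_nonneg_right h5 (Real.exp_pos _).le
        _ ≤ _ := h6
  obtain ⟨j, rfl⟩ := Nat.exists_eq_add_of_le hmu
  push_cast at hu
  refine le_trans ?_ (ind j huv hu)
  apply mul_le_mul_of_nonneg_left _ (bpm_pos h0 h1 (by omega)).le
  apply Real.exp_le_exp.2
  have hj : (j : ℝ) ≤ (w + 8) / 4 := by linarith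
  have : y * j ≤ y * ((w + 8) / 4) := mul_le_mul_of_nonneg_left hj hypos.le
  have e : y * ((w + 8) / 4) = 1 / (8 * (q * (1 - q))) := by
    rw [hy]; field_simp; ring
  linarith

lemma const_bound {q : ℝ} (h0 : 0 < q) (h1 : q < 1) :
    4 * Real.exp (1 / (8 * (q * (1 - q)))) ≤
      √(2 * Real.pi * q * (1 - q)) * Real.exp (1 / (2 * q * (1 - q))) := by
  have hq1 : 0 < 1 - q := by linarith
  set s := q * (1 - q) with hs
  have hspos : 0 < s := by positivity
  have hs4 : s ≤ 1 / 4 := by nlinarith [sq_nonneg (2 * q - 1)]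
  have e1 : 2 * Real.pi * q * (1 - q) = 2 * Real.pi * s := by rw [hs]; ring
  have e2 : 1 / (2 * q * (1 - q)) = 3 / (8 * s) + 1 / (8 * s) := by
    rw [hs]; field_simp; norm_num
  rw [e1, e2, Real.exp_add, ← mul_assoc (√(2 * Real.pi * s))]
  apply mul_le_mul_of_nonneg_right _ (Real.exp_pos _).le
  apply le_of_sq_le_sq _ (by positivity)
  rw [mul_pow, Real.sq_sqrt (by positivity), ← Real.exp_nat_mul]
  have e3 : ((2 : ℕ) : ℝ) * (3 / (8 * s)) = 3 + 3 * (1 / (4 * s) - 1) := by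
    push_cast; field_simp; ring
  rw [e3, Real.exp_add]
  have hx : 1 ≤ 1 / (4 * s) := by rw [le_div_iff₀ (by positivity)]; linarith
  have h3 : 1 / (4 * s) ≤ Real.exp (3 * (1 / (4 * s) - 1)) := by
    have := Real.add_one_le_exp (3 * (1 / (4 * s) - 1))
    linarith
  have h4 : (16 : ℝ) ≤ Real.exp 3 := by
    have h := Real.exp_one_gt_d9
    have : Real.exp 3 = Real.exp 1 ^ 3 := by rw [← Real.exp_nat_mul]; norm_num
    rw [this]
    calc (16 : ℝ) ≤ 2.7 ^ 3 := by norm_num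
      _ ≤ _ := pow_le_pow_left₀ (by norm_num) (by linarith) 3
  have h5 := Real.pi_gt_three
  calc (4 : ℝ) ^ 2 = 2 * 2 * s * (16 * (1 / (4 * s))) := by field_simp; norm_num
    _ ≤ 2 * Real.pi * s * (Real.exp 3 * Real.exp (3 * (1 / (4 * s) - 1))) := by
      gcongr
      linarith

/-- local lower bound for the binomial law -/
lemma bpm_lower {v u : ℕ} {q : ℝ} (h0 : 0 < q) (h1 : q < 1)
    (hv : 8 + 1 / (2 * (q * (1 - q))) ≤ √v) (huv : u ≤ v)
    (hu : |(u : ℝ) - v * q| ≤ √v / 4) :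
    2 / ((√(2 * Real.pi * q * (1 - q)) * Real.exp (1 / (2 * q * (1 - q)))) * √(3 * v))
      ≤ bpm v q u := by
  have hq1 : 0 < 1 - q := by linarith
  have hs : 0 < 1 / (2 * (q * (1 - q))) := by positivity
  have hw : 8 ≤ √(v : ℝ) := by linarith
  have hvpos : 0 < v := by
    rcases Nat.eq_zero_or_pos v with h | h
    · subst h; simp at hw; linarith
    · exact h
  obtain ⟨m, hmv, hm1, hm2⟩ := bpm_mode h0 h1 hvpos
  rw [abs_le] at hm1 hu
  have key : bpm v q m * Real.exp (-(1 / (8 * (q * (1 - q))))) ≤ bpm v q u := by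
    rcases le_total m u with h | h
    · apply bpm_up h0 h1 _ h huv (by linarith) (by linarith)
      refine le_trans ?_ hv
      gcongr
      nlinarith
    · rw [bpm_symm q hmv, bpm_symm q huv]
      have e : q * (1 - q) = (1 - q) * (1 - (1 - q)) := by ring
      rw [e]
      have c1 : ((v - m : ℕ) : ℝ) = v - m := by push_cast [hmv]; ring
      have c2 : ((v - u : ℕ) : ℝ) = v - u := by push_cast [huv]; ring
      apply bpm_up hq1 (by linarith) _ (by omega) (by omega) (by rw [c1]; linarith)
        (by rw [c2]; linarith)
      refine le_trans ?_ hv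
      gcongr
      nlinarith
  refine le_trans ?_ key
  have hb := const_bound h0 h1
  set b := √(2 * Real.pi * q * (1 - q)) * Real.exp (1 / (2 * q * (1 - q)))
  set E := Real.exp (1 / (8 * (q * (1 - q)))) with hE
  have hEpos : 0 < E := Real.exp_pos _
  have hbpos : 0 < b := by linarith
  rw [Real.exp_neg, ← hE]
  have h3 : 1.7 * √(v : ℝ) ≤ √(3 * v) := by
    apply Real.le_sqrt_of_sq_le
    rw [mul_pow, Real.sq_sqrt (by positivity)]
    have : (0 : ℝ) ≤ v := by positivity
    nlinarith
  have h4 : 3 / 4 / (2 * √(v : ℝ) + 1) ≤ bpm v q m := by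
    rw [div_le_iff₀ (by positivity)]; linarith
  calc 2 / (b * √(3 * v)) ≤ 2 / ((4 * E) * (1.7 * √(v : ℝ))) := by gcongr
    _ ≤ 3 / 4 / (2 * √(v : ℝ) + 1) * E⁻¹ := by
      rw [← div_eq_mul_inv, div_div, div_le_div_iff₀ (by positivity) (by positivity)]
      nlinarith
    _ ≤ _ := by gcongr
/-! ### Part 5: assembly -/

lemma bpm_unique {v : ℕ} {q : ℝ} (h0 : 0 < q) (h1 : q < 1) (m : ℕ → ℝ)
    (hm : ∀ u < v, m u * ((v : ℝ) - u) * q = m (u + 1) * (u + 1) * (1 - q)) :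
    ∀ u ≤ v, m u = (∑ k ∈ range (v + 1), m k) * bpm v q u := by
  have hq1 : 0 < 1 - q := by linarith
  have key : ∀ u ≤ v, m u * bpm v q 0 = m 0 * bpm v q u := by
    intro u
    induction u with
    | zero => intro _; rfl
    | succ u ih =>
      intro hu
      have i := ih (by omega)
      have a := hm u (by omega)
      have b := bpm_rec q (show u < v by omega)
      have hc : (0 : ℝ) < (u + 1) * (1 - q) := by positivity
      apply mul_right_cancel₀ hc.ne'
      calc m (u + 1) * bpm v q 0 * ((u + 1) * (1 - q))
          = (m (u + 1) * (u + 1) * (1 - q)) * bpm v q 0 := by ring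
        _ = (m u * bpm v q 0) * (((v : ℝ) - u) * q) := by rw [← a]; ring
        _ = m 0 * (bpm v q u * ((v : ℝ) - u) * q) := by rw [i]; ring
        _ = _ := by rw [b]; ring
  have hp := bpm_pos (q := q) h0 h1 (Nat.zero_le v)
  have hs : (∑ k ∈ range (v + 1), m k) * bpm v q 0 = m 0 := by
    rw [Finset.sum_mul]
    calc _ = ∑ k ∈ range (v + 1), m 0 * bpm v q k := by
          apply Finset.sum_congr rfl
          intro k hk
          exact key k (by rw [Finset.mem_range] at hk; omega)
      _ = m 0 := by rw [← Finset.mul_sum, bpm_sum, mul_one]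
  intro u hu
  apply mul_right_cancel₀ hp.ne'
  rw [key u hu, ← hs]
  ring

lemma count_lemma (l e : ℕ → ℝ) (a b : ℕ) (ε t μ : ℝ) (hε : 0 < ε) (ht : 0 ≤ t)
    (he : ∀ u ∈ Finset.Icc a b, 0 ≤ e u)
    (hl : ∀ u, a ≤ u → u < b → ε - e u ≤ l (u + 1) - l u) :
    ((Finset.Icc a b).card : ℝ) - 1 - (2 * t + ∑ u ∈ Finset.Icc a b, e u) / ε
      ≤ (((Finset.Icc a b).filter (fun u => t ≤ |l u - μ|)).card : ℝ) := by
  set W := Finset.Icc a b with hW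
  have hsum0 : 0 ≤ ∑ u ∈ W, e u := Finset.sum_nonneg he
  have hcard : (W.filter (fun u => t ≤ |l u - μ|)).card
      + (W.filter (fun u => ¬ t ≤ |l u - μ|)).card = W.card :=
    Finset.card_filter_add_card_filter_not _
  have hcard' : ((W.filter (fun u => t ≤ |l u - μ|)).card : ℝ)
      + (W.filter (fun u => ¬ t ≤ |l u - μ|)).card = W.card := by exact_mod_cast hcard
  set X := W.filter (fun u => ¬ t ≤ |l u - μ|) with hX
  suffices h : (X.card : ℝ) ≤ 1 + (2 * t + ∑ u ∈ W, e u) / ε by linarith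
  rcases X.eq_empty_or_nonempty with h0 | hne
  · rw [h0]
    have : 0 ≤ (2 * t + ∑ u ∈ W, e u) / ε := by positivity
    simp; linarith
  set u1 := X.min' hne
  set u2 := X.max' hne
  have hu1 : u1 ∈ X := X.min'_mem hne
  have hu2 : u2 ∈ X := X.max'_mem hne
  have h12 : u1 ≤ u2 := X.min'_le _ hu2
  rw [hX, Finset.mem_filter, hW, Finset.mem_Icc, not_le, abs_lt] at hu1 hu2
  have hc : X.card ≤ u2 + 1 - u1 := by
    rw [← Nat.card_Icc]
    apply Finset.card_le_card
    intro x hx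
    rw [Finset.mem_Icc]
    exact ⟨X.min'_le _ hx, X.le_max' _ hx⟩
  have grow : ∀ j : ℕ, u1 + j ≤ b →
      ε * j - ∑ k ∈ Finset.Ico u1 (u1 + j), e k ≤ l (u1 + j) - l u1 := by
    intro j
    induction j with
    | zero => intro _; simp
    | succ j ih =>
      intro hj
      have i := ih (by omega)
      have s := hl (u1 + j) (by omega) (by omega)
      rw [← add_assoc, Finset.sum_Ico_succ_top (by omega)]
      push_cast
      linarith
  have g := grow (u2 - u1) (by omega)
  rw [Nat.add_sub_cancel' h12, Nat.cast_sub h12] at g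
  have hsub : ∑ k ∈ Finset.Ico u1 u2, e k ≤ ∑ u ∈ W, e u := by
    apply Finset.sum_le_sum_of_subset_of_nonneg
    · intro x hx
      rw [Finset.mem_Ico] at hx
      rw [hW, Finset.mem_Icc]; omega
    · intro i hi _; exact he i hi
  have hc' : (X.card : ℝ) ≤ 1 + ((u2 : ℝ) - u1) := by
    have : X.card + u1 ≤ u2 + 1 := by omega
    have : (X.card : ℝ) + u1 ≤ u2 + 1 := by exact_mod_cast this
    linarith
  have : (u2 : ℝ) - u1 ≤ (2 * t + ∑ u ∈ W, e u) / ε := by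
    rw [le_div_iff₀ hε]
    linarith
  linarith

lemma moment_lemma {Ω : Type*} (s : Finset Ω) (P L : Ω → ℝ) (hP : ∀ z ∈ s, 0 ≤ P z) (μ t r : ℝ)
    (ht : 0 < t) (hr : 1 ≤ r) (h : t * (∑ z ∈ s, P z) ≤ |∑ z ∈ s, P z * (L z - μ)|) :
    (∑ z ∈ s, P z) * t ^ r ≤ ∑ z ∈ s, P z * |L z - μ| ^ r := by
  have tan : ∀ x : ℝ, 0 ≤ x → t ^ r + r * t ^ (r - 1) * (x - t) ≤ x ^ r := by
    intro x hx
    have hb := one_add_mul_self_le_rpow_one_add (s := x / t - 1)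
      (by have : 0 ≤ x / t := by positivity
          linarith) hr
    have e : 1 + (x / t - 1) = x / t := by ring
    rw [e, Real.div_rpow hx ht.le, le_div_iff₀ (by positivity)] at hb
    rw [Real.rpow_sub_one ht.ne']
    calc _ = (1 + r * (x / t - 1)) * t ^ r := by field_simp
      _ ≤ _ := hb
  have h1 : |∑ z ∈ s, P z * (L z - μ)| ≤ ∑ z ∈ s, P z * |L z - μ| := by
    refine (Finset.abs_sum_le_sum_abs _ _).trans (le_of_eq ?_)
    apply Finset.sum_congr rfl
    intro z hz
    rw [abs_mul, abs_of_nonneg (hP z hz)]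
  calc (∑ z ∈ s, P z) * t ^ r
      ≤ (∑ z ∈ s, P z) * t ^ r + r * t ^ (r - 1) *
        ((∑ z ∈ s, P z * |L z - μ|) - t * (∑ z ∈ s, P z)) := by
        have : 0 ≤ r * t ^ (r - 1) *
            ((∑ z ∈ s, P z * |L z - μ|) - t * (∑ z ∈ s, P z)) := by
          apply mul_nonneg (by positivity)
          linarith
        linarith
    _ = ∑ z ∈ s, P z * (t ^ r + r * t ^ (r - 1) * (|L z - μ| - t)) := by
        simp only [mul_add, mul_sub, Finset.sum_add_distrib, Finset.sum_sub_distrib,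
          Finset.sum_mul, Finset.mul_sum]
        congr 2
        · apply Finset.sum_congr rfl; intro z _; ring
        · apply Finset.sum_congr rfl; intro z _; ring
    _ ≤ _ := Finset.sum_le_sum fun z hz =>
        mul_le_mul_of_nonneg_left (tan _ (abs_nonneg _)) (hP z hz)

lemma per_v (m s h Φ : ℕ → ℝ) (M : ℝ) (hM : 0 < M) (v : ℕ) (q : ℝ) (h0 : 0 < q) (h1 : q < 1)
    (hm : ∀ u ≤ v, m u = M * bpm v q u) (hh : ∀ u, 0 ≤ h u) (hΦ : ∀ u, 0 ≤ Φ u)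
    (ε t τ μ ρ : ℝ) (hε : 0 < ε) (ht : 0 ≤ t) (hτ : 0 ≤ τ) (hρ : 0 ≤ ρ)
    (hmom : ∀ u ≤ v, t * m u ≤ |s u - μ * m u| → m u * τ ≤ Φ u)
    (hstep : ∀ u < v, ε * m u - h u ≤ m u * (s (u + 1) / m (u + 1)) - s u)
    (a b : ℕ) (hb : b ≤ v) (hW : ∀ u ∈ Finset.Icc a b, ρ ≤ bpm v q u) :
    τ * (M * ρ * (((Finset.Icc a b).card : ℝ) - 1 - 2 * t / ε) - (∑ u ∈ range (v + 1), h u) / ε)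
      ≤ ∑ u ∈ range (v + 1), Φ u := by
  have hmpos : ∀ u ≤ v, 0 < m u := fun u hu => by
    rw [hm u hu]; exact mul_pos hM (bpm_pos h0 h1 hu)
  set l : ℕ → ℝ := fun u => s u / m u with hl
  set e : ℕ → ℝ := fun u => h u / m u with he
  have hIcc : ∀ u ∈ Finset.Icc a b, u ≤ v := fun u hu => by
    rw [Finset.mem_Icc] at hu; omega
  have hc := count_lemma l e a b ε t μ hε ht
    (fun u hu => div_nonneg (hh u) (hmpos u (hIcc u hu)).le)
    (fun u hu1 hu2 => by
      have hp := hmpos u (by omega)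
      have hs := hstep u (by omega)
      apply le_of_mul_le_mul_left _ hp
      simp only [hl, he]
      calc m u * (ε - h u / m u) = ε * m u - h u := by field_simp
        _ ≤ _ := hs
        _ = _ := by field_simp)
  set W := Finset.Icc a b with hWdef
  set G := W.filter (fun u => t ≤ |l u - μ|) with hG
  have hGle : M * ρ * G.card * τ ≤ ∑ u ∈ range (v + 1), Φ u := by
    calc M * ρ * G.card * τ = ∑ u ∈ G, M * ρ * τ := by simp; ring
      _ ≤ ∑ u ∈ G, Φ u := by
        apply Finset.sum_le_sum
        intro u hu
        rw [hG, Finset.mem_filter] at hu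
        have huv := hIcc u hu.1
        have hp := hmpos u huv
        refine le_trans ?_ (hmom u huv ?_)
        · apply mul_le_mul_of_nonneg_right _ hτ
          rw [hm u huv]
          exact mul_le_mul_of_nonneg_left (hW u hu.1) hM.le
        · have : s u - μ * m u = m u * (l u - μ) := by simp only [hl]; field_simp
          rw [this, abs_mul, abs_of_pos hp, mul_comm t]
          exact mul_le_mul_of_nonneg_left hu.2 hp.le
      _ ≤ _ := by
        apply Finset.sum_le_sum_of_subset_of_nonneg
        · intro u hu
          rw [hG, Finset.mem_filter] at hu
          have := hIcc u hu.1
          rw [Finset.mem_range]; omega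
        · intro u _ _; exact hΦ u
  have hMρ : 0 ≤ M * ρ := by positivity
  have hsum : M * ρ * ∑ u ∈ W, e u ≤ ∑ u ∈ range (v + 1), h u := by
    rw [Finset.mul_sum]
    calc _ ≤ ∑ u ∈ W, h u := by
          apply Finset.sum_le_sum
          intro u hu
          have huv := hIcc u hu
          have hp := hmpos u huv
          simp only [he]
          rw [mul_div_assoc', div_le_iff₀ hp, mul_comm]
          apply mul_le_mul_of_nonneg_left _ (hh u)
          rw [hm u huv]
          exact mul_le_mul_of_nonneg_left (hW u hu) hM.le
      _ ≤ _ := by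
        apply Finset.sum_le_sum_of_subset_of_nonneg
        · intro u hu
          have := hIcc u hu
          rw [Finset.mem_range]; omega
        · intro u _ _; exact hh u
  refine le_trans ?_ hGle
  rw [mul_comm τ]
  apply mul_le_mul_of_nonneg_right _ hτ
  have h3 := mul_le_mul_of_nonneg_left hc hMρ
  refine le_trans ?_ h3
  have h4 : (M * ρ * ∑ u ∈ W, e u) / ε ≤ (∑ u ∈ range (v + 1), h u) / ε := by gcongr
  have h5 : M * ρ * ((W.card : ℝ) - 1 - (2 * t + ∑ u ∈ W, e u) / ε)
      = M * ρ * ((W.card : ℝ) - 1 - 2 * t / ε) - (M * ρ * ∑ u ∈ W, e u) / ε := by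
    field_simp; ring
  rw [h5]
  linarith

lemma sum_level {S : Type*} [Fintype S] [DecidableEq S] (A B D : S) (n : ℕ)
    (g : (Fin n → S) → ℝ) :
    ∑ z, g z = ∑ v ∈ range (n / 3 + 1), ∑ u ∈ range (v + 1), ∑ z ∈ level A B D n v u, g z := by
  rw [← Finset.sum_fiberwise_of_maps_to (s := univ) (t := range (n / 3 + 1))
    (g := fun z => (tset A B n z).card)]
  · apply Finset.sum_congr rfl
    intro v _
    rw [← Finset.sum_fiberwise_of_maps_to (t := range (v + 1))
      (g := fun z => (iset A B D n z).card)]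
    · apply Finset.sum_congr rfl
      intro u _
      apply Finset.sum_congr _ fun _ _ => rfl
      rw [Finset.filter_filter]
      rfl
    · intro z hz
      rw [Finset.mem_filter] at hz
      have := card_tset A B D n z
      rw [Finset.mem_range]; omega
  · intro z _
    have := Finset.card_le_univ (tset A B n z)
    rw [Fintype.card_fin] at this
    rw [Finset.mem_range]; omega

lemma tset_card_trip {S : Type*} [DecidableEq S] (A B : S) (n : ℕ) (z : Fin n → S) :
    ∑ i, trip A B n i z = ((tset A B n z).card : ℝ) := by
  unfold tset
  rw [← Finset.sum_boole]
  apply Finset.sum_congr rfl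
  intro i _
  simp only [trip, ind]
  split_ifs <;> simp_all

lemma window {v : ℕ} {q : ℝ} (h0 : 0 < q) (h1 : q < 1)
    (hv : 8 + 1 / (2 * (q * (1 - q))) ≤ √v) :
    ∃ a b : ℕ, b ≤ v ∧ √v / 2 - 1 ≤ ((Finset.Icc a b).card : ℝ) ∧
      ∀ u ∈ Finset.Icc a b, |(u : ℝ) - v * q| ≤ √v / 4 := by
  have hq1 : 0 < 1 - q := by linarith
  set w := √(v : ℝ) with hw
  have hww : (v : ℝ) = w * w := (Real.mul_self_sqrt (by positivity)).symm
  have hs : 0 < 1 / (2 * (q * (1 - q))) := by positivity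
  have hw8 : 8 ≤ w := by linarith
  have h2 : 1 ≤ w * (2 * (q * (1 - q))) := by
    have : 1 / (2 * (q * (1 - q))) ≤ w := by linarith
    rwa [div_le_iff₀ (by positivity)] at this
  have hwq : 1 ≤ 4 * (w * q) := by nlinarith [mul_pos (show 0 < w by linarith) h0]
  have hwq1 : 1 ≤ 4 * (w * (1 - q)) := by nlinarith [mul_pos (show 0 < w by linarith) hq1]
  have hx : 0 ≤ v * q - w / 4 := by rw [hww]; nlinarith
  have hy : v * q + w / 4 ≤ v := by
    have : w / 4 ≤ w * w * (1 - q) := by nlinarith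
    rw [hww]; linarith
  have hy0 : 0 ≤ v * q + w / 4 := by linarith
  refine ⟨⌈v * q - w / 4⌉₊, ⌊v * q + w / 4⌋₊, ?_, ?_, ?_⟩
  · have := Nat.floor_le hy0
    exact_mod_cast this.trans hy
  · rw [Nat.card_Icc]
    have a1 := Nat.ceil_lt_add_one hx
    have a2 := Nat.lt_floor_add_one (v * q + w / 4)
    have : ⌊v * q + w / 4⌋₊ + 1 ≤ (⌊v * q + w / 4⌋₊ + 1 - ⌈v * q - w / 4⌉₊) + ⌈v * q - w / 4⌉₊ := by
      omega
    have : (⌊v * q + w / 4⌋₊ : ℝ) + 1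
        ≤ ((⌊v * q + w / 4⌋₊ + 1 - ⌈v * q - w / 4⌉₊ : ℕ) : ℝ) + ⌈v * q - w / 4⌉₊ := by
      exact_mod_cast this
    linarith
  · intro u hu
    rw [Finset.mem_Icc] at hu
    have a1 := Nat.le_ceil (v * q - w / 4)
    have a2 := Nat.floor_le hy0
    have a3 : (⌈v * q - w / 4⌉₊ : ℝ) ≤ u := by exact_mod_cast hu.1
    have a4 : (u : ℝ) ≤ ⌊v * q + w / 4⌋₊ := by exact_mod_cast hu.2
    rw [abs_le]
    constructor <;> linarith

lemma level_bound {S : Type*} [Fintype S] [DecidableEq S] (A B D : S) (n : ℕ)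
    (π : S → ℝ) (p : S → S → ℝ) (hP : ∀ z, 0 ≤ chainLaw π p n z) (q : ℝ) (h0 : 0 < q) (h1 : q < 1)
    (hQ : 0 < ∑ C, p A C * p C B) (hq : q = p A D * p D B / ∑ C, p A C * p C B)
    (L : (Fin n → S) → ℝ) (ε t μ r : ℝ) (hε : 0 < ε) (ht : 0 < t) (hr : 1 ≤ r)
    (η : (Fin n → S) → ℝ) (hη0 : ∀ z, 0 ≤ η z)
    (hη : ∀ z, ε - η z ≤ (∑ z', kernelR A B D n z z' * L z') - L z)
    (v : ℕ) (hv : 8 + 1 / (2 * (q * (1 - q))) ≤ √v) (hvn : 3 * v ≤ n)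
    (htv : 2 * t / ε ≤ √v / 4) (ht2 : 2 ≤ 2 * t / ε) :
    t ^ r * ((∑ u ∈ range (v + 1), ∑ z ∈ level A B D n v u, chainLaw π p n z) *
      (2 / ((√(2 * Real.pi * q * (1 - q)) * Real.exp (1 / (2 * q * (1 - q)))) * √n))
        * (2 * t / ε - 2)
      - (∑ u ∈ range (v + 1), ∑ z ∈ level A B D n v u, chainLaw π p n z * η z) / ε)
    ≤ ∑ u ∈ range (v + 1), ∑ z ∈ level A B D n v u, chainLaw π p n z * |L z - μ| ^ r := by
  set ρ := 2 / ((√(2 * Real.pi * q * (1 - q)) * Real.exp (1 / (2 * q * (1 - q)))) * √n) with hρ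
  have hq1 : 0 < 1 - q := by linarith
  have hρ0 : 0 ≤ ρ := by positivity
  set m : ℕ → ℝ := fun u => ∑ z ∈ level A B D n v u, chainLaw π p n z with hm
  set s : ℕ → ℝ := fun u => ∑ z ∈ level A B D n v u, chainLaw π p n z * L z with hs
  set h : ℕ → ℝ := fun u => ∑ z ∈ level A B D n v u, chainLaw π p n z * η z with hh
  set Φ : ℕ → ℝ := fun u => ∑ z ∈ level A B D n v u, chainLaw π p n z * |L z - μ| ^ r with hΦ
  have hm0 : ∀ u, 0 ≤ m u := fun u => Finset.sum_nonneg fun z _ => hP z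
  have hh0 : ∀ u, 0 ≤ h u := fun u => Finset.sum_nonneg fun z _ => mul_nonneg (hP z) (hη0 z)
  have hΦ0 : ∀ u, 0 ≤ Φ u := fun u =>
    Finset.sum_nonneg fun z _ => mul_nonneg (hP z) (Real.rpow_nonneg (abs_nonneg _) r)
  have hτ : 0 ≤ t ^ r := Real.rpow_nonneg ht.le r
  set M := ∑ u ∈ range (v + 1), m u with hMdef
  have hM0 : 0 ≤ M := Finset.sum_nonneg fun u _ => hm0 u
  rcases hM0.eq_or_lt with hMz | hMpos
  · rw [← hMz]
    have a1 : 0 ≤ (∑ u ∈ range (v + 1), h u) / ε :=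
      div_nonneg (Finset.sum_nonneg fun u _ => hh0 u) hε.le
    have a2 : 0 ≤ ∑ u ∈ range (v + 1), Φ u := Finset.sum_nonneg fun u _ => hΦ0 u
    refine le_trans ?_ a2
    apply mul_nonpos_of_nonneg_of_nonpos hτ
    simp only [zero_mul, zero_sub]
    linarith
  have rec1 : ∀ u < v, m u * ((v : ℝ) - u) * q = m (u + 1) * (u + 1) * (1 - q) := by
    intro u hu
    have tr := transport A B D n π p q hQ hq (fun _ => 1) v u hu
    simp only [mul_one] at tr
    rw [← tr]
    congr 2
    apply Finset.sum_congr rfl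
    intro z hz
    simp only [level, Finset.mem_filter, Finset.mem_univ, true_and] at hz
    have hc := card_tset A B D n z
    have hne : (jset A B D n z).Nonempty := by
      rw [← Finset.card_pos]; omega
    have hk := kernel_apply A B D n (fun _ => 1) z hne
    have hcp : (0 : ℝ) < (jset A B D n z).card := by exact_mod_cast hne.card_pos
    have : ∑ z', kernelR A B D n z z' = 1 := by
      apply mul_left_cancel₀ hcp.ne'
      simpa using hk
    rw [this, mul_one]
  have hmb := bpm_unique h0 h1 m rec1
  obtain ⟨a, b, hb, hcard, hwin⟩ := window h0 h1 hv
  have hnpos : 0 < n := by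
    have : v ≠ 0 := by
      rintro rfl
      have : 0 < 1 / (2 * (q * (1 - q))) := by positivity
      simp at hv
      simp at this
      nlinarith
    omega
  have main := per_v m s h Φ M hMpos v q h0 h1 hmb hh0 hΦ0 ε t (t ^ r) μ ρ hε ht.le hτ hρ0
    (by
      intro u hu hcond
      apply moment_lemma _ _ _ (fun z _ => hP z) μ t r ht hr
      have : ∑ z ∈ level A B D n v u, chainLaw π p n z * (L z - μ) = s u - μ * m u := by
        simp only [hs, hm, mul_sub, Finset.sum_sub_distrib, Finset.mul_sum]
        congr 1
        apply Finset.sum_congr rfl; intro z _; ring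
      rw [this]
      exact hcond)
    (by
      intro u hu
      have tr := transport A B D n π p q hQ hq L v u hu
      have mp1 : 0 < m (u + 1) := by
        rw [hmb (u + 1) (by omega)]; exact mul_pos hMpos (bpm_pos h0 h1 (by omega))
      have huv : (0 : ℝ) < (v : ℝ) - u := by
        have : (u : ℝ) < v := by exact_mod_cast hu
        linarith
      have hR : m u * (s (u + 1) / m (u + 1))
          = ∑ z ∈ level A B D n v u, chainLaw π p n z * ∑ z', kernelR A B D n z z' * L z' := by
        rw [mul_div_assoc', div_eq_iff mp1.ne']
        have hc : 0 < ((v : ℝ) - u) * q := by positivity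
        apply mul_right_cancel₀ hc.ne'
        have r1 := rec1 u hu
        calc m u * s (u + 1) * (((v : ℝ) - u) * q)
            = s (u + 1) * (m u * ((v : ℝ) - u) * q) := by ring
          _ = m (u + 1) * (s (u + 1) * (u + 1) * (1 - q)) := by rw [r1]; ring
          _ = _ := by rw [← tr]; ring
      rw [hR]
      simp only [hs, hm, hh]
      rw [Finset.mul_sum, ← Finset.sum_sub_distrib, ← Finset.sum_sub_distrib]
      apply Finset.sum_le_sum
      intro z _
      have := mul_le_mul_of_nonneg_left (hη z) (hP z)
      linarith)
    a b hb
    (by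
      intro u hu
      have hub : u ≤ v := by rw [Finset.mem_Icc] at hu; omega
      refine le_trans ?_ (bpm_lower h0 h1 hv hub (hwin u hu))
      rw [hρ]
      have : (3 * v : ℝ) ≤ n := by exact_mod_cast hvn
      have hv0 : (0 : ℝ) < v := by
        have : 0 < √(v : ℝ) := by
          have : 0 < 1 / (2 * (q * (1 - q))) := by positivity
          linarith
        exact Real.sqrt_pos.1 this
      gcongr)
  refine le_trans ?_ main
  apply mul_le_mul_of_nonneg_left _ hτ
  have : M * ρ * (2 * t / ε - 2) ≤ M * ρ * (((Finset.Icc a b).card : ℝ) - 1 - 2 * t / ε) := by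
    apply mul_le_mul_of_nonneg_left _ (by positivity)
    linarith
  linarith

lemma kernel_lower {S : Type*} [Fintype S] [DecidableEq S] (A B D : S) (n : ℕ)
    (L : (Fin n → S) → ℝ) (K : ℝ) (hK : 0 ≤ K) (z : Fin n → S)
    (hL : ∀ i d, L z - K ≤ L (Function.update z i d)) :
    -K ≤ (∑ z', kernelR A B D n z z' * L z') - L z := by
  classical
  by_cases hne : (jset A B D n z).Nonempty
  · have hk := kernel_apply A B D n L z hne
    have hcp : (0 : ℝ) < (jset A B D n z).card := by exact_mod_cast hne.card_pos
    have : ((jset A B D n z).card : ℝ) * (L z - K)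
        ≤ (jset A B D n z).card * ∑ z', kernelR A B D n z z' * L z' := by
      rw [hk, ← nsmul_eq_mul]
      exact Finset.card_nsmul_le_sum _ _ _ fun i _ => hL _ _
    have := le_of_mul_le_mul_left this hcp
    linarith
  · have : ∀ z', kernelR A B D n z z' = if z' = z then 1 else 0 := by
      intro z'
      unfold kernelR
      simp only
      rw [if_neg]
      · congr
      · intro h
        apply hne
        convert h
        ext i; simp [jset]
    simp only [this]
    simp
    exact hK

lemma main_bound {S : Type*} [Fintype S] [DecidableEq S] (A B D : S) (n : ℕ)
    (π : S → ℝ) (p : S → S → ℝ) (hP : ∀ z, 0 ≤ chainLaw π p n z)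
    (hP1 : ∑ z, chainLaw π p n z = 1) (q : ℝ) (h0 : 0 < q) (h1 : q < 1)
    (hQ : 0 < ∑ C, p A C * p C B) (hq : q = p A D * p D B / ∑ C, p A C * p C B)
    (L : (Fin n → S) → ℝ) (ε t μ r K Δ α : ℝ) (hε : 0 < ε) (hr : 1 ≤ r) (hK : 0 ≤ K)
    (hL : ∀ z i d, L z - K ≤ L (Function.update z i d))
    (hA1 : prOf (chainLaw π p n)
        (fun z => ε ≤ (∑ z', kernelR A B D n z z' * L z') - L z) ≥ 1 - Δ)
    (ht : t = ε * √(2 * α * n) / 16)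
    (hn1 : 8 + 1 / (2 * (q * (1 - q))) ≤ √(α * n / 2))
    (hn2 : 16 ≤ √(2 * α * n))
    (hV : 1 / 2 ≤ ∑ z, if α * n / 2 ≤ ∑ i, trip A B n i z then chainLaw π p n z else 0) :
    t ^ r * ((1 / 2) *
      (2 / ((√(2 * Real.pi * q * (1 - q)) * Real.exp (1 / (2 * q * (1 - q)))) * √n))
        * (√(2 * α * n) / 8 - 2) - (ε + K) * Δ / ε)
      ≤ ∑ z, chainLaw π p n z * |L z - μ| ^ r := by
  classical
  set ρ := 2 / ((√(2 * Real.pi * q * (1 - q)) * Real.exp (1 / (2 * q * (1 - q)))) * √n) with hρ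
  have hq1 : 0 < 1 - q := by linarith
  have hρ0 : 0 ≤ ρ := by positivity
  have ht0 : 0 < t := by rw [ht]; have : 0 < √(2 * α * n) := by linarith
                         positivity
  have h2t : 2 * t / ε = √(2 * α * n) / 8 := by rw [ht]; field_simp; ring
  set T := √(2 * α * n) / 8 with hT
  have hT2 : 2 ≤ T := by rw [hT]; linarith
  have hτ : 0 ≤ t ^ r := Real.rpow_nonneg ht0.le r
  set G : (Fin n → S) → ℝ := fun z => (∑ z', kernelR A B D n z z' * L z') - L z with hG
  set η : (Fin n → S) → ℝ := fun z => max 0 (ε - G z) with hη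
  have hη0 : ∀ z, 0 ≤ η z := fun z => le_max_left _ _
  have hη1 : ∀ z, ε - η z ≤ G z := fun z => by
    have := le_max_right 0 (ε - G z)
    simp only [hη]; linarith
  have hGK : ∀ z, -K ≤ G z := fun z => kernel_lower A B D n L K hK z (hL z)
  have hEη : ∑ z, chainLaw π p n z * η z ≤ (ε + K) * Δ := by
    have a1 : ∑ z, chainLaw π p n z * η z
        ≤ ∑ z, (ε + K) * (chainLaw π p n z - if ε ≤ G z then chainLaw π p n z else 0) := by
      apply Finset.sum_le_sum
      intro z _
      by_cases hz : ε ≤ G z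
      · have : η z = 0 := max_eq_left (by linarith)
        rw [this, if_pos hz]; simp
      · have : η z ≤ ε + K := max_le (by linarith) (by linarith [hGK z])
        rw [if_neg hz, sub_zero, mul_comm]
        exact mul_le_mul_of_nonneg_right this (hP z)
    have a2 : 1 - Δ ≤ ∑ z, if ε ≤ G z then chainLaw π p n z else 0 := by
      have := hA1
      unfold prOf at this
      convert this
    rw [← Finset.mul_sum, Finset.sum_sub_distrib, hP1] at a1
    refine a1.trans (mul_le_mul_of_nonneg_left (by linarith) (by linarith))
  rw [sum_level A B D n] at hV hEη ⊢
  have key : ∀ v ∈ range (n / 3 + 1),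
      t ^ r * ((∑ u ∈ range (v + 1), ∑ z ∈ level A B D n v u,
          if α * n / 2 ≤ ∑ i, trip A B n i z then chainLaw π p n z else 0) * ρ * (T - 2)
        - (∑ u ∈ range (v + 1), ∑ z ∈ level A B D n v u, chainLaw π p n z * η z) / ε)
      ≤ ∑ u ∈ range (v + 1), ∑ z ∈ level A B D n v u, chainLaw π p n z * |L z - μ| ^ r := by
    intro v hv
    have hvn : 3 * v ≤ n := by rw [Finset.mem_range] at hv; omega
    have e1 : ∑ u ∈ range (v + 1), ∑ z ∈ level A B D n v u,
          (if α * n / 2 ≤ ∑ i, trip A B n i z then chainLaw π p n z else 0)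
        = ∑ u ∈ range (v + 1), ∑ z ∈ level A B D n v u,
          (if α * n / 2 ≤ (v : ℝ) then chainLaw π p n z else 0) := by
      apply Finset.sum_congr rfl; intro u _
      apply Finset.sum_congr rfl; intro z hz
      simp only [level, Finset.mem_filter, Finset.mem_univ, true_and] at hz
      rw [tset_card_trip, hz.1]
    rw [e1]
    by_cases hc : α * n / 2 ≤ (v : ℝ)
    · simp only [if_pos hc]
      have hs : √(α * n / 2) ≤ √v := Real.sqrt_le_sqrt hc
      have hs2 : √(2 * α * n) ≤ 2 * √v := by
        rw [Real.sqrt_le_left (by positivity), mul_pow, Real.sq_sqrt (by positivity)]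
        linarith
      have := level_bound A B D n π p hP q h0 h1 hQ hq L ε t μ r hε ht0 hr η hη0 hη1 v
        (hn1.trans hs) hvn (by rw [h2t, hT]; linarith) (by rw [h2t]; exact hT2)
      rw [h2t] at this
      exact this
    · simp only [if_neg hc]
      have a1 : 0 ≤ (∑ u ∈ range (v + 1), ∑ z ∈ level A B D n v u, chainLaw π p n z * η z) / ε :=
        div_nonneg (Finset.sum_nonneg fun u _ => Finset.sum_nonneg fun z _ =>
          mul_nonneg (hP z) (hη0 z)) hε.le
      have a2 : 0 ≤ ∑ u ∈ range (v + 1), ∑ z ∈ level A B D n v u,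
          chainLaw π p n z * |L z - μ| ^ r :=
        Finset.sum_nonneg fun u _ => Finset.sum_nonneg fun z _ =>
          mul_nonneg (hP z) (Real.rpow_nonneg (abs_nonneg _) r)
      refine le_trans ?_ a2
      apply mul_nonpos_of_nonneg_of_nonpos hτ
      simp only [Finset.sum_const_zero, zero_mul, zero_sub]
      linarith
  refine le_trans ?_ (Finset.sum_le_sum key)
  rw [← Finset.mul_sum, Finset.sum_sub_distrib, ← Finset.sum_div, ← Finset.sum_mul,
    ← Finset.sum_mul]
  apply mul_le_mul_of_nonneg_left _ hτ
  apply sub_le_sub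
  · apply mul_le_mul_of_nonneg_right _ (by linarith)
    exact mul_le_mul_of_nonneg_right hV hρ0
  · exact div_le_div_of_nonneg_right hEη hε.le

lemma main_all
    {𝔸 : Type*} [Fintype 𝔸] [DecidableEq 𝔸]
    (p : (𝔸 × 𝔸) → (𝔸 × 𝔸) → ℝ)
    (hpnn : ∀ x y, 0 ≤ p x y) (hprow : ∀ x, ∑ y, p x y = 1)
    (π : (𝔸 × 𝔸) → ℝ) (hπnn : ∀ x, 0 ≤ π x) (hπsum : ∑ x, π x = 1)
    (hstat : ∀ y, ∑ x, π x * p x y = π y)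
    (haper : ∃ m : ℕ, ∀ x y, 0 < (Matrix.of p ^ m) x y)
    (A B D : 𝔸 × 𝔸)
    (hAB : 0 < π A * ∑ C : 𝔸 × 𝔸, p A C * p C B)
    (q : ℝ) (hq : q = p A D * p D B / ∑ D' : 𝔸 × 𝔸, p A D' * p D' B)
    (hqpos : 0 < q)
    (Ssc : 𝔸 → 𝔸 → ℝ) (hSsc : ∀ a b, 0 ≤ Ssc a b) (δ : ℝ)
    -- assumption (A1)
    (ε : ℝ) (hε : 0 < ε)
    (Δ : ℕ → ℝ) (hΔ : Filter.Tendsto Δ Filter.atTop (nhds 0))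
    (hA1 : ∀ n : ℕ, prOf (chainLaw π p n)
        (fun z => ε ≤ (∑ z', kernelR A B D n z z' * scoreL Ssc δ n z')
          - scoreL Ssc δ n z) ≥ 1 - Δ n)
    -- the data of the conclusion
    (α : ℝ) (hα : α = (1 / 3) * (π A * ∑ C : 𝔸 × 𝔸, p A C * p C B))
    (co : ℝ) (hco : 0 < co)
    (hco' : co < Real.sqrt (2 * α) /
      (8 * (Real.sqrt (2 * Real.pi * q * (1 - q)) * Real.exp (1 / (2 * q * (1 - q)))))) :
    ∀ r : ℝ, 1 ≤ r → (∀ᶠ n in Filter.atTop,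
      (∑ z, chainLaw π p n z *
          |scoreL Ssc δ n z - ∑ w, chainLaw π p n w * scoreL Ssc δ n w| ^ r)
        ≥ co * (ε * Real.sqrt (2 * α) / 16) ^ r * (n : ℝ) ^ (r / 2)) := by
  intro r hr
  have hπA : 0 ≤ π A := hπnn A
  have hQ : 0 < ∑ C : 𝔸 × 𝔸, p A C * p C B := by
    by_contra hc
    push Not at hc
    have := mul_nonpos_of_nonneg_of_nonpos hπA hc
    linarith
  have hα0 : 0 < α := by rw [hα]; linarith
  have hqle : q ≤ 1 := by
    rw [hq, div_le_one hQ]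
    exact Finset.single_le_sum (f := fun C => p A C * p C B)
      (fun C _ => mul_nonneg (hpnn _ _) (hpnn _ _)) (Finset.mem_univ D)
  have hq1 : q < 1 := by
    rcases hqle.lt_or_eq with h | h
    · exact h
    · rw [h] at hco'
      simp at hco'
      linarith
  have h1q : 0 < 1 - q := by linarith
  set b := Real.sqrt (2 * Real.pi * q * (1 - q)) * Real.exp (1 / (2 * q * (1 - q))) with hb
  have hpi := Real.pi_pos
  have hb0 : 0 < b := by positivity
  set C := ∑ a, ∑ b, Ssc a b with hC
  have hC0 : 0 ≤ C := Finset.sum_nonneg fun a _ => Finset.sum_nonneg fun b _ => hSsc a b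
  have hCle : ∀ a b, Ssc a b ≤ C := fun a b =>
    (Finset.single_le_sum (f := fun b => Ssc a b) (fun b _ => hSsc a b) (Finset.mem_univ b)).trans
      (Finset.single_le_sum (f := fun a => ∑ b, Ssc a b)
        (fun a _ => Finset.sum_nonneg fun b _ => hSsc a b) (Finset.mem_univ a))
  have hsn : Filter.Tendsto (fun n : ℕ => √(n : ℝ)) Filter.atTop Filter.atTop :=
    Real.tendsto_sqrt_atTop.comp tendsto_natCast_atTop_atTop
  have hlim : Filter.Tendsto (fun n : ℕ => (√(2 * α) / 8 - 2 * (√(n : ℝ))⁻¹) / b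
      - (ε + 2 * C) * Δ n / ε) Filter.atTop
      (nhds ((√(2 * α) / 8 - 2 * 0) / b - (ε + 2 * C) * 0 / ε)) := by
    have l1 : Filter.Tendsto (fun n : ℕ => (√(n : ℝ))⁻¹) Filter.atTop (nhds 0) :=
      tendsto_inv_atTop_zero.comp hsn
    exact ((tendsto_const_nhds.sub (l1.const_mul 2)).div_const b).sub
      ((hΔ.const_mul (ε + 2 * C)).div_const ε)
  have hlt : co < (√(2 * α) / 8 - 2 * 0) / b - (ε + 2 * C) * 0 / ε := by
    have : (√(2 * α) / 8 - 2 * 0) / b - (ε + 2 * C) * 0 / ε = √(2 * α) / (8 * b) := by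
      simp [div_div]
    rw [this]; exact hco'
  have hev := hlim.eventually (lt_mem_nhds hlt)
  have hs1 : 0 < √(α / 2) := by positivity
  have hs2 : 0 < √(2 * α) := by positivity
  have ev1 := (hsn.const_mul_atTop hs1).eventually_ge_atTop (8 + 1 / (2 * (q * (1 - q))))
  have ev2 := (hsn.const_mul_atTop hs2).eventually_ge_atTop 16
  filter_upwards [hev, ev1, ev2, V_large p hpnn hprow π hπnn hπsum hstat haper A B α hα hα0,
    Filter.eventually_gt_atTop 0] with n hn hn1 hn2 hV hnpos
  have hnR : (0 : ℝ) < n := by exact_mod_cast hnpos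
  have e1 : √(α * n / 2) = √(α / 2) * √(n : ℝ) := by
    rw [← Real.sqrt_mul (by positivity)]; congr 1; ring
  have e2 : √(2 * α * n) = √(2 * α) * √(n : ℝ) := Real.sqrt_mul (by positivity) _
  have hsn0 : 0 < √(n : ℝ) := Real.sqrt_pos.2 hnR
  have mb := main_bound A B D n π p (fun z => chainLaw_nonneg π p hπnn hpnn n z)
    (chainLaw_sum π p hπsum hprow n) q hqpos hq1 hQ hq (scoreL Ssc δ n) ε
    (ε * √(2 * α * n) / 16) (∑ w, chainLaw π p n w * scoreL Ssc δ n w) r (2 * C) (Δ n) α hε hr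
    (by positivity) (fun z i d => score_lip Ssc δ C hSsc hCle hC0 n z i d) (hA1 n) rfl
    (by rw [e1]; exact hn1) (by rw [e2]; exact hn2) hV
  refine le_trans ?_ mb
  have e3 : (ε * √(2 * α * n) / 16) ^ r = (ε * √(2 * α) / 16) ^ r * (n : ℝ) ^ (r / 2) := by
    rw [e2, show ε * (√(2 * α) * √(n : ℝ)) / 16 = (ε * √(2 * α) / 16) * √(n : ℝ) by ring,
      Real.mul_rpow (by positivity) hsn0.le, Real.sqrt_eq_rpow (n : ℝ), ← Real.rpow_mul hnR.le]
    congr 2; ring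
  have e4 : (1 / 2) * (2 / (b * √(n : ℝ))) * (√(2 * α * n) / 8 - 2)
      = (√(2 * α) / 8 - 2 * (√(n : ℝ))⁻¹) / b := by
    rw [e2]; field_simp
  rw [e3, ← hb, e4, mul_assoc, mul_comm co]
  exact mul_le_mul_of_nonneg_left hn.le (by positivity)

/-- under assumption (A1) for the random transformation `𝓡` of the
pairwise-Markov-chain construction, for every `r ≥ 1` and every
`c_o ∈ (0, √(2α)/(8 b(q)))`, for all sufficiently large `n`:
`E|L(Z) - E L(Z)|^r ≥ c_o (ε_o √(2α)/16)^r n^{r/2}`; in particular (taking `r = 2`)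
`Var(L(Z)) ≥ a_o n` with `a_o = 2 c_o α ε_o²/16²`. Here
`α = (1/3) P(Z₁ = 𝐀, Z₃ = 𝐁)` and `b(q) = √(2πq(1-q)) exp(1/(2q(1-q)))`. -/
theorem PMC_central_moment_lower_bound
    {𝔸 : Type*} [Fintype 𝔸] [DecidableEq 𝔸]
    (p : (𝔸 × 𝔸) → (𝔸 × 𝔸) → ℝ)
    (hpnn : ∀ x y, 0 ≤ p x y) (hprow : ∀ x, ∑ y, p x y = 1)
    (π : (𝔸 × 𝔸) → ℝ) (hπnn : ∀ x, 0 ≤ π x) (hπsum : ∑ x, π x = 1)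
    (hstat : ∀ y, ∑ x, π x * p x y = π y)
    (haper : ∃ m : ℕ, ∀ x y, 0 < (Matrix.of p ^ m) x y)
    (A B D : 𝔸 × 𝔸)
    (hAB : 0 < π A * ∑ C : 𝔸 × 𝔸, p A C * p C B)
    (q : ℝ) (hq : q = p A D * p D B / ∑ D' : 𝔸 × 𝔸, p A D' * p D' B)
    (hqpos : 0 < q)
    (Ssc : 𝔸 → 𝔸 → ℝ) (hSsc : ∀ a b, 0 ≤ Ssc a b) (δ : ℝ)
    -- assumption (A1)
    (ε : ℝ) (hε : 0 < ε)
    (Δ : ℕ → ℝ) (hΔ : Filter.Tendsto Δ Filter.atTop (nhds 0))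
    (hA1 : ∀ n : ℕ, prOf (chainLaw π p n)
        (fun z => ε ≤ (∑ z', kernelR A B D n z z' * scoreL Ssc δ n z')
          - scoreL Ssc δ n z) ≥ 1 - Δ n)
    -- the data of the conclusion
    (α : ℝ) (hα : α = (1 / 3) * (π A * ∑ C : 𝔸 × 𝔸, p A C * p C B))
    (r : ℝ) (hr : 1 ≤ r)
    (co : ℝ) (hco : 0 < co)
    (hco' : co < Real.sqrt (2 * α) /
      (8 * (Real.sqrt (2 * Real.pi * q * (1 - q)) * Real.exp (1 / (2 * q * (1 - q)))))) :
    (∀ᶠ n in Filter.atTop,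
      (∑ z, chainLaw π p n z *
          |scoreL Ssc δ n z - ∑ w, chainLaw π p n w * scoreL Ssc δ n w| ^ r)
        ≥ co * (ε * Real.sqrt (2 * α) / 16) ^ r * (n : ℝ) ^ (r / 2)) ∧
    (∀ᶠ n in Filter.atTop,
      (∑ z, chainLaw π p n z *
          (scoreL Ssc δ n z - ∑ w, chainLaw π p n w * scoreL Ssc δ n w) ^ 2)
        ≥ (2 * co * α / 16 ^ 2 * ε ^ 2) * (n : ℝ)) := by
  have H := main_all p hpnn hprow π hπnn hπsum hstat haper A B D hAB q hq hqpos Ssc hSsc δ ε hε Δ hΔ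
    hA1 α hα co hco hco'
  refine ⟨H r hr, ?_⟩
  have hα0 : 0 < α := by rw [hα]; linarith
  filter_upwards [H 2 (by norm_num)] with n hn
  have e : co * (ε * Real.sqrt (2 * α) / 16) ^ (2 : ℝ) * (n : ℝ) ^ ((2 : ℝ) / 2)
      = (2 * co * α / 16 ^ 2 * ε ^ 2) * (n : ℝ) := by
    rw [Real.rpow_two, div_pow, mul_pow, Real.sq_sqrt (by positivity), div_self two_ne_zero,
      Real.rpow_one]
    ring
  rw [e] at hn
  simpa only [Real.rpow_two, sq_abs] using hn
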